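/- Hoeffding-type concentration inequality for the pseudo-marginal PaRIS: under (H1) and (H2), for every n ∈ ℕ, ε ∈ ℰ, additive functional h_n, and M ∈ ℕ with M ≥ 1, there exist constants c_n > 0 and d_n > 0 such that for all N ≥ 1 and all ϵ > 0, P( | Σ_{i=1}^N (ω_n^i/Ω_n) τ_n^i − φ^ε_{0:n} h_n | ≥ ϵ ) ≤ c_n exp(−d_n N ϵ²), where (ξ_n^i, τ_n^i, ω_n^i)_{i=1}^N is the output of n iterations of the pseudo-marginal PaRIS and Ω_n = Σ_{i=1}^N ω_n^i. -/

import Mathlib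

open MeasureTheory ProbabilityTheory Filter

namespace PmParis

variable {X : ℕ → Type*} [∀ n, MeasurableSpace (X n)]
/-- Path space `X_0 × ⋯ × X_n`. -/
abbrev Path (X : ℕ → Type*) (n : ℕ) := (i : Fin (n + 1)) → X i

/-- Unnormalised path integral `χ L_0 ⋯ L_{n-1} h`, where `L_k` is the kernel with
density `d k` with respect to `μ (k+1)`. -/
noncomputable def pathInt (μ : ∀ n, Measure (X n)) (χ : Measure (X 0))
    (d : ∀ k, X k → X (k + 1) → ℝ) : (n : ℕ) → (Path X n → ℝ) → ℝ
  | 0, h => ∫ x, h (Fin.cons x fun i => i.elim0) ∂χ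
  | n + 1, h =>
      pathInt μ χ d n fun p =>
        ∫ y, d n (p (Fin.last n)) y * h (Fin.snoc p y) ∂μ (n + 1)

/-- The (normalised) path measure `φ_{0:n}` as an integral functional. -/
noncomputable def smoothPath (μ : ∀ n, Measure (X n)) (χ : Measure (X 0))
    (d : ∀ k, X k → X (k + 1) → ℝ) (n : ℕ) (h : Path X n → ℝ) : ℝ :=
  pathInt μ χ d n h / pathInt μ χ d n fun _ => 1

/-- Last-coordinate marginal `φ_n` of `φ_{0:n}`, as an integral functional. -/
noncomputable def marg (μ : ∀ n, Measure (X n)) (χ : Measure (X 0))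
    (d : ∀ k, X k → X (k + 1) → ℝ) (n : ℕ) (f : X n → ℝ) : ℝ :=
  smoothPath μ χ d n fun p => f (p (Fin.last n))

/-- The kernel operator `L_n f (x) = ∫ d n x y * f y dμ (n+1)`. -/
noncomputable def Lop (μ : ∀ n, Measure (X n))
    (d : ∀ k, X k → X (k + 1) → ℝ) (n : ℕ) (f : X (n + 1) → ℝ) (x : X n) : ℝ :=
  ∫ y, d n x y * f y ∂μ (n + 1)

/-- The backward kernel operator `B_n g (x') = φ_n(d n (·) x' * g) / φ_n(d n (·) x')`. -/
noncomputable def Bop (μ : ∀ n, Measure (X n)) (χ : Measure (X 0))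
    (d : ∀ k, X k → X (k + 1) → ℝ) (n : ℕ) (g : X n → ℝ) (x' : X (n + 1)) : ℝ :=
  marg μ χ d n (fun x => d n x x' * g x) / marg μ χ d n fun x => d n x x'

/-- `T_n h (x_n) = ∫ h(x_{0:n}) ∏_{m<n} B_m(x_{m+1}, dx_m)`: iterated backward kernel. -/
noncomputable def Tback (μ : ∀ n, Measure (X n)) (χ : Measure (X 0))
    (d : ∀ k, X k → X (k + 1) → ℝ) : (n : ℕ) → (Path X n → ℝ) → X n → ℝ
  | 0, h, x => h (Fin.cons x fun i => i.elim0)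
  | n + 1, h, x' =>
      Bop μ χ d n (fun x => Tback μ χ d n (fun p => h (Fin.snoc p x')) x) x'

/-- Iterated kernel `L_m ⋯ L_{n-1} f` evaluated at level `m` (equal to `f` when `m = n`,
junk `0` when `m > n`). -/
noncomputable def Kpow (μ : ∀ n, Measure (X n))
    (d : ∀ k, X k → X (k + 1) → ℝ) (n : ℕ) (f : X n → ℝ) (m : ℕ) : X m → ℝ :=
  if _hm : m < n then fun x => ∫ y, d m x y * Kpow μ d n f (m + 1) y ∂μ (m + 1)
  else fun x => if hm2 : m = n then f (hm2 ▸ x) else 0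
termination_by n - m
decreasing_by omega

/-- Prospective (forward) integral: given a prefix `x_{0:m}`, integrate `h` over the
remaining coordinates `x_{m+1:n}` using the kernels with densities `d`. -/
noncomputable def Fwd (μ : ∀ n, Measure (X n))
    (d : ∀ k, X k → X (k + 1) → ℝ) (n : ℕ) (h : Path X n → ℝ) (m : ℕ) :
    Path X m → ℝ :=
  if _hm : m < n then fun p =>
    ∫ y, d m (p (Fin.last m)) y * Fwd μ d n h (m + 1) (Fin.snoc p y) ∂μ (m + 1)
  else fun p => if hm2 : m = n then h (cast (congrArg (Path X) hm2) p) else 0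
termination_by n - m
decreasing_by omega

/-- Additive functional `h_n(x_{0:n}) = ∑_{m<n} h̃_m(x_m, x_{m+1})`. -/
noncomputable def addFun (htil : ∀ k, X k → X (k + 1) → ℝ) (n : ℕ) (p : Path X n) : ℝ :=
  ∑ m : Fin n, htil m (p m.castSucc) (p m.succ)

/-- Mixed retrospective–prospective kernel: backward with `B`s of the family `dB`,
forward with kernels of the family `dF`. -/
noncomputable def mixOp (μ : ∀ n, Measure (X n)) (χ : Measure (X 0))
    (dB dF : ∀ k, X k → X (k + 1) → ℝ) (n : ℕ) (h : Path X n → ℝ) (m : ℕ) (x : X m) : ℝ :=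
  Tback μ χ dB m (Fwd μ dF n h m) x

/-- Centered retrospective–prospective kernel `𝓡̄_{m,n} h = 𝓡_{m,n}(h − φ_{0:n} h)`. -/
noncomputable def Rbar (μ : ∀ n, Measure (X n)) (χ : Measure (X 0))
    (d : ∀ k, X k → X (k + 1) → ℝ) (n : ℕ) (h : Path X n → ℝ) (m : ℕ) (x : X m) : ℝ :=
  mixOp μ χ d d n (fun p => h p - smoothPath μ χ d n h) m x

variable {Z : ℕ → Type*} [∀ n, MeasurableSpace (Z n)]

/-- Normalise a measure to a probability measure (junk if the total mass is `0` or `∞`). -/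
noncomputable def normalize {α : Type*} [MeasurableSpace α] (m : Measure α) : Measure α :=
  (m Set.univ)⁻¹ • m

/-- State of the particle system at time `n`: for each particle index, the particle
position `ξ`, the PaRIS statistic `τ` and the importance weight `ω`. -/
abbrev PState (X : ℕ → Type*) (N n : ℕ) := Fin N → X n × ℝ × ℝ

/-- Law of one pair `(J, ζ)` of backward index and auxiliary variable: the distribution on
`{1,…,N} × Z` proportional to `ω^j ℓ̂_n⟨z⟩(ξ^j, x') R_n(ξ^j, x', dz)`. -/
noncomputable def bwdMeas (R : ∀ k, Kernel (X k × X (k + 1)) (Z k))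
    (lhat : ∀ k, X k → X (k + 1) → Z k → ℝ) {N : ℕ} (n : ℕ)
    (s : PState X N n) (x' : X (n + 1)) : Measure (Fin N × Z n) :=
  normalize (Measure.sum fun j : Fin N =>
    (((R n ((s j).1, x')).withDensity fun z =>
        ENNReal.ofReal ((s j).2.2 * lhat n (s j).1 x' z)).map fun z => (j, z)))

/-- Law of the backward-sampling statistic
`τ' = M⁻¹ ∑_{j<M} (τ^{J_j} + h̃_n(ξ^{J_j}, x'))` based on `M` i.i.d. draws from `bwdMeas`. -/
noncomputable def bsLaw (R : ∀ k, Kernel (X k × X (k + 1)) (Z k))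
    (lhat : ∀ k, X k → X (k + 1) → Z k → ℝ)
    (htil : ∀ k, X k → X (k + 1) → ℝ) {N : ℕ} (M n : ℕ)
    (s : PState X N n) (x' : X (n + 1)) : Measure ℝ :=
  (Measure.pi fun _ : Fin M => bwdMeas R lhat n s x').map fun J =>
    (M : ℝ)⁻¹ * ∑ j : Fin M, ((s (J j).1).2.1 + htil n (s (J j).1).1 x')

/-- Conditional law of one new particle triple `(ξ', τ', ω')` given the time-`n` state `s`
(pseudo-marginal PaRIS update). -/
noncomputable def partLaw (μ : ∀ n, Measure (X n))
    (R : ∀ k, Kernel (X k × X (k + 1)) (Z k))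
    (lhat : ∀ k, X k → X (k + 1) → Z k → ℝ)
    (htil : ∀ k, X k → X (k + 1) → ℝ)
    (ϑ : ∀ k, X k → ℝ) (pr : ∀ k, X k → X (k + 1) → ℝ) {N : ℕ} (M n : ℕ)
    (s : PState X N n) : Measure (X (n + 1) × ℝ × ℝ) :=
  normalize (Measure.sum fun I : Fin N =>
    ENNReal.ofReal (ϑ n (s I).1 * (s I).2.2) •
      (((μ (n + 1)).withDensity fun y => ENNReal.ofReal (pr n (s I).1 y)).bind fun x' =>
        ((bsLaw R lhat htil M n s x').prod
            ((R n ((s I).1, x')).map fun z =>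
              lhat n (s I).1 x' z / (ϑ n (s I).1 * pr n (s I).1 x'))).map
          fun q => (x', q.1, q.2)))

/-- Law of the whole particle system produced by `n` iterations of the pseudo-marginal
PaRIS algorithm with `N` particles and `M` backward samples. -/
noncomputable def sysLaw (μ : ∀ n, Measure (X n)) (ν : Measure (X 0))
    (R : ∀ k, Kernel (X k × X (k + 1)) (Z k))
    (lhat : ∀ k, X k → X (k + 1) → Z k → ℝ)
    (htil : ∀ k, X k → X (k + 1) → ℝ)
    (ϑ : ∀ k, X k → ℝ) (pr : ∀ k, X k → X (k + 1) → ℝ)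
    (wm1 : X 0 → ℝ) (N M : ℕ) : (n : ℕ) → Measure (PState X N n)
  | 0 => (Measure.pi fun _ : Fin N => ν).map fun ξ i => (ξ i, 0, wm1 (ξ i))
  | n + 1 =>
      (sysLaw μ ν R lhat htil ϑ pr wm1 N M n).bind fun s =>
        Measure.pi fun _ : Fin N => partLaw μ R lhat htil ϑ pr M n s

/-- Self-normalised PaRIS estimator `∑_i (ω^i/Ω) τ^i`. -/
noncomputable def estParis {N n : ℕ} (s : PState X N n) : ℝ :=
  (∑ i, (s i).2.2 * (s i).2.1) / ∑ i, (s i).2.2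

/-- Estimated transition density `ℓ^ε_n(x, y) := ∫ ℓ̂_n⟨z⟩(x, y) R_n(x, y, dz)`. -/
noncomputable def lEps (R : ∀ k, Kernel (X k × X (k + 1)) (Z k))
    (lhat : ∀ k, X k → X (k + 1) → Z k → ℝ) (k : ℕ) (x : X k) (y : X (k + 1)) : ℝ :=
  ∫ z, lhat k x y z ∂(R k (x, y))

section Concentration

lemma hoeffding_pi {α : Type*} [MeasurableSpace α] (P : Measure α) [IsProbabilityMeasure P]
    {g : α → ℝ} (hg : Measurable g) {B : ℝ} (hB : 0 < B) (hgB : ∀ᵐ x ∂P, |g x| ≤ B)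
    {N : ℕ} (hN : 1 ≤ N) {ε : ℝ} (hε : 0 < ε) :
    Measure.pi (fun _ : Fin N => P) {x | ε ≤ |(∑ i, g (x i)) / N - ∫ a, g a ∂P|} ≤
      ENNReal.ofReal (2 * Real.exp (-((2 * B ^ 2)⁻¹ * N * ε ^ 2))) := by
  have hN0 : (0 : ℝ) < N := by exact_mod_cast hN
  have one_sided : ∀ k : α → ℝ, Measurable k → (∀ᵐ x ∂P, |k x| ≤ B) →
      (Measure.pi fun _ : Fin N => P).real {x | N * ε ≤ ∑ i, (k (x i) - ∫ a, k a ∂P)} ≤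
        Real.exp (-((2 * B ^ 2)⁻¹ * N * ε ^ 2)) := by
    intro k hk hkB
    have hsub := hasSubgaussianMGF_of_mem_Icc (μ := P) (a := -B) (b := B) hk.aemeasurable
      (by filter_upwards [hkB] with x hx using abs_le.mp hx)
    have hsubi : ∀ i ∈ (Finset.univ : Finset (Fin N)),
        HasSubgaussianMGF (fun x : Fin N → α => k (x i) - ∫ a, k a ∂P)
          ((‖B - -B‖₊ / 2) ^ 2) (Measure.pi fun _ : Fin N => P) := by
      intro i _
      refine HasSubgaussianMGF.of_map (Y := fun x : Fin N → α => x i) (X := fun a => k a - ∫ a, k a ∂P)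
        (measurable_pi_apply i).aemeasurable ?_
      rwa [(measurePreserving_eval (fun _ : Fin N => P) i).map_eq]
    have hind : iIndepFun (fun (i : Fin N) (x : Fin N → α) => k (x i) - ∫ a, k a ∂P)
        (Measure.pi fun _ : Fin N => P) :=
      iIndepFun_pi (X := fun _ a => k a - ∫ a, k a ∂P) fun _ => (hk.sub_const _).aemeasurable
    have h := HasSubgaussianMGF.measure_sum_ge_le_of_iIndepFun hind hsubi
      (ε := N * ε) (by positivity)
    refine h.trans_eq ?_
    congr 1
    have : ((‖B - -B‖₊ / 2 : NNReal) : ℝ) = B := by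
      have h2 : |B - -B| = 2 * B := by rw [abs_of_pos] <;> linarith
      rw [NNReal.coe_div, coe_nnnorm, Real.norm_eq_abs, h2]
      simp
    rw [NNReal.coe_sum]
    simp only [NNReal.coe_pow, this, Finset.sum_const, Finset.card_univ, Fintype.card_fin,
      nsmul_eq_mul]
    field_simp
  have h1 := one_sided g hg hgB
  have h2 := one_sided (fun a => - g a) hg.neg (by simpa using hgB)
  have hsub : {x : Fin N → α | ε ≤ |(∑ i, g (x i)) / N - ∫ a, g a ∂P|} ⊆
      {x | N * ε ≤ ∑ i, (g (x i) - ∫ a, g a ∂P)} ∪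
      {x | N * ε ≤ ∑ i, (- g (x i) - ∫ a, - g a ∂P)} := by
    intro x hx
    simp only [Set.mem_ofPred_eq, Set.mem_union, Finset.sum_sub_distrib, Finset.sum_neg_distrib,
      integral_neg, Finset.sum_const, Finset.card_univ, Fintype.card_fin, nsmul_eq_mul] at hx ⊢
    have hid : ∑ i, g (x i) = N * ((∑ i, g (x i)) / N) := by field_simp
    rw [hid]
    rcases le_abs.mp hx with h | h
    · left; nlinarith
    · right; nlinarith
  calc _ ≤ _ := measure_mono hsub
    _ ≤ _ := measure_union_le _ _
    _ ≤ ENNReal.ofReal (Real.exp (-((2 * B ^ 2)⁻¹ * N * ε ^ 2))) +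
        ENNReal.ofReal (Real.exp (-((2 * B ^ 2)⁻¹ * N * ε ^ 2))) := by
      rw [← ofReal_measureReal, ← ofReal_measureReal]
      gcongr
    _ = _ := by
      rw [← ENNReal.ofReal_add (by positivity) (by positivity), ← two_mul]

/-- Exponential concentration at Gaussian rate, uniformly in the sample size `N ≥ 1`. -/
def ExpConc {Ω : ℕ → Type*} [∀ N, MeasurableSpace (Ω N)] (P : ∀ N, Measure (Ω N))
    (G : ∀ N, Ω N → ℝ) (t : ℝ) : Prop :=
  ∃ c > (0 : ℝ), ∃ d > (0 : ℝ), ∀ N : ℕ, 1 ≤ N → ∀ ε : ℝ, 0 < ε →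
    P N {s | ε ≤ |G N s - t|} ≤ ENNReal.ofReal (c * Real.exp (-(d * N * ε ^ 2)))

variable {Ω Ω' : ℕ → Type*} [∀ N, MeasurableSpace (Ω N)] [∀ N, MeasurableSpace (Ω' N)]
  {P : ∀ N, Measure (Ω N)}

lemma ofReal_exp_add_le {c₁ c₂ a : ℝ} (d₁ d₂ k₁ k₂ ε : ℝ) (hc₁ : 0 < c₁) (hc₂ : 0 < c₂)
    (ha : 0 ≤ a) :
    ENNReal.ofReal (c₁ * Real.exp (-(d₁ * a * (ε * k₁) ^ 2))) +
        ENNReal.ofReal (c₂ * Real.exp (-(d₂ * a * (ε * k₂) ^ 2))) ≤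
      ENNReal.ofReal ((c₁ + c₂) *
        Real.exp (-(min (d₁ * k₁ ^ 2) (d₂ * k₂ ^ 2) * a * ε ^ 2))) := by
  have e (d k : ℝ) : d * a * (ε * k) ^ 2 = d * k ^ 2 * a * ε ^ 2 := by ring
  rw [← ENNReal.ofReal_add (by positivity) (by positivity), add_mul, e, e]
  gcongr
  · exact min_le_left _ _
  · exact min_le_right _ _

lemma ExpConc.div {U V : ∀ N, Ω N → ℝ} {u v C : ℝ} (hU : ExpConc P U u) (hV : ExpConc P V v)
    (hv : 0 < v) (hC : 0 < C) (hUV : ∀ N, ∀ᵐ s ∂P N, |U N s| ≤ C * V N s) :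
    ExpConc P (fun N s => U N s / V N s) (u / v) := by
  obtain ⟨c₁, hc₁, d₁, hd₁, h₁⟩ := hU
  obtain ⟨c₂, hc₂, d₂, hd₂, h₂⟩ := hV
  refine ⟨c₁ + c₂, by positivity, min (d₁ * (v / 2) ^ 2) (d₂ * (v / (2 * C)) ^ 2),
    by positivity, fun N hN ε hε => ?_⟩
  have hsub : {s | ε ≤ |U N s / V N s - u / v|} ≤ᵐ[P N]
      ({s | ε * (v / 2) ≤ |U N s - u|} ∪ {s | ε * (v / (2 * C)) ≤ |V N s - v|} : Set (Ω N)) := by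
    filter_upwards [hUV N] with s hs hmem
    by_contra hcon
    have hmem' : ε ≤ |U N s / V N s - u / v| := hmem
    obtain ⟨hu', hv'⟩ : |U N s - u| < ε * (v / 2) ∧ |V N s - v| < ε * (v / (2 * C)) := by
      constructor
      · by_contra h
        exact hcon (Or.inl (not_lt.mp h))
      · by_contra h
        exact hcon (Or.inr (not_lt.mp h))
    have hVnn : 0 ≤ V N s := by
      by_contra h
      nlinarith [abs_nonneg (U N s)]
    have hq : |U N s / V N s| ≤ C := by
      rw [abs_div, abs_of_nonneg hVnn]
      exact div_le_of_le_mul₀ hVnn hC.le hs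
    have hid : U N s / V N s - u / v =
        ((U N s / V N s) * (v - V N s) + (U N s - u)) / v := by
      rcases eq_or_ne (V N s) 0 with h0 | h0
      · have hU0 : U N s = 0 := by simpa [h0] using hs
        simp [h0, hU0, neg_div]
      · field_simp
        ring
    rw [hid, abs_div, abs_of_pos hv, le_div_iff₀ hv] at hmem'
    have h1 : |U N s / V N s * (v - V N s) + (U N s - u)| ≤ C * |V N s - v| + |U N s - u| := by
      refine (abs_add_le _ _).trans ?_
      rw [abs_mul, abs_sub_comm v]
      gcongr
    have h2 : C * |V N s - v| < ε * (v / 2) := by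
      calc _ < C * (ε * (v / (2 * C))) := by gcongr
        _ = _ := by field_simp
    linarith
  calc _ ≤ _ := measure_mono_ae hsub
    _ ≤ _ := measure_union_le _ _
    _ ≤ _ := add_le_add (h₁ N hN _ (by positivity)) (h₂ N hN _ (by positivity))
    _ ≤ _ := ofReal_exp_add_le _ _ _ _ _ hc₁ hc₂ (Nat.cast_nonneg N)

lemma ExpConc.bind {K : ∀ N, Ω N → Measure (Ω' N)} {G : ∀ N, Ω' N → ℝ} {m : ∀ N, Ω N → ℝ}
    {t b : ℝ} (hP : ∀ N, P N Set.univ ≤ 1) (hm : ExpConc P m t) (hG : ∀ N, Measurable (G N))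
    (hb : 0 < b)
    (hK : ∀ N, 1 ≤ N → ∀ᵐ s ∂P N, ∀ ε : ℝ, 0 < ε → K N s {s' | ε ≤ |G N s' - m N s|} ≤
      ENNReal.ofReal (2 * Real.exp (-(b * N * ε ^ 2))))
    (hK1 : ∀ N, 1 ≤ N → ∀ᵐ s ∂P N, K N s Set.univ ≤ 1) :
    ExpConc (fun N => (P N).bind (K N)) G t := by
  obtain ⟨c, hc, d, hd, h⟩ := hm
  refine ⟨2 + c, by positivity, min (b * 2⁻¹ ^ 2) (d * 2⁻¹ ^ 2), by positivity, fun N hN ε hε => ?_⟩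
  have hmeas : MeasurableSet {s' | ε ≤ |G N s' - t|} :=
    measurableSet_le measurable_const ((hG N).sub_const t).abs
  have hpt : ∀ᵐ s ∂P N, K N s {s' | ε ≤ |G N s' - t|} ≤
      ENNReal.ofReal (2 * Real.exp (-(b * N * (ε * 2⁻¹) ^ 2))) +
        {s | ε * 2⁻¹ ≤ |m N s - t|}.indicator (fun _ => 1) s := by
    filter_upwards [hK N hN, hK1 N hN] with s hs hs1
    by_cases hmem : ε * 2⁻¹ ≤ |m N s - t|
    · rw [Set.indicator_of_mem (by exact hmem)]
      exact ((measure_mono (Set.subset_univ _)).trans hs1).trans le_add_self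
    · refine le_trans (measure_mono ?_) ((hs (ε * 2⁻¹) (by positivity)).trans le_self_add)
      intro s' hs'
      simp only [Set.mem_ofPred_eq] at hs' ⊢
      have := abs_sub_le (G N s') (m N s) t
      linarith
  calc _ ≤ ∫⁻ s, K N s {s' | ε ≤ |G N s' - t|} ∂P N := Measure.bind_apply_le _ hmeas
    _ ≤ _ := lintegral_mono_ae hpt
    _ = _ := lintegral_add_left measurable_const _
    _ ≤ ENNReal.ofReal (2 * Real.exp (-(b * N * (ε * 2⁻¹) ^ 2))) +
        P N {s | ε * 2⁻¹ ≤ |m N s - t|} := by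
      gcongr
      · rw [lintegral_const]
        exact mul_le_of_le_one_right' (hP N)
      · exact (lintegral_indicator_const_le _ _).trans (one_mul _).le
    _ ≤ _ := add_le_add le_rfl (h N hN _ (by positivity))
    _ ≤ _ := ofReal_exp_add_le _ _ _ _ _ two_pos hc (Nat.cast_nonneg N)

end Concentration

section Kernels

lemma integral_bind_of_bounded {α β : Type*} [MeasurableSpace α] [MeasurableSpace β]
    {m : Measure α} [IsProbabilityMeasure m] {κ : α → Measure β} (hκ : Measurable κ)
    [∀ a, IsProbabilityMeasure (κ a)] {f : β → ℝ} (hf : Measurable f) {C : ℝ}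
    (hC : ∀ᵐ b ∂(m.bind κ), |f b| ≤ C) :
    ∫ b, f b ∂(m.bind κ) = ∫ a, ∫ b, f b ∂κ a ∂m := by
  let K : Kernel α β := ⟨κ, hκ⟩
  have : IsMarkovKernel K := ⟨fun a => inferInstanceAs (IsProbabilityMeasure (κ a))⟩
  have e : m.bind κ = (K ∘ₖ Kernel.const Unit m) () := by
    simp [K]
  rw [e] at hC ⊢
  rw [Kernel.integral_comp]
  · simp [K]
  · exact Integrable.of_bound hf.aestronglyMeasurable C (by simpa using hC)

lemma measurable_measure_pi {α β ι : Type*} [MeasurableSpace α] [MeasurableSpace β] [Fintype ι]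
    {κ : α → Measure β} (hκ : Measurable κ) [∀ a, IsProbabilityMeasure (κ a)] :
    Measurable fun a => Measure.pi fun _ : ι => κ a := by
  refine Measurable.measure_of_isPiSystem_of_isProbabilityMeasure generateFrom_pi.symm
    isPiSystem_pi ?_
  rintro _ ⟨t, ht, rfl⟩
  simp only [Measure.pi_pi]
  exact Finset.measurable_prod _ fun i _ =>
    (Measure.measurable_coe (ht i (Set.mem_univ i))).comp hκ

lemma measurable_map_uncurry {α β γ : Type*} [MeasurableSpace α] [MeasurableSpace β]
    [MeasurableSpace γ] {κ : α → Measure β} (hκ : Measurable κ) [∀ a, IsProbabilityMeasure (κ a)]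
    {g : α → β → γ} (hg : Measurable fun q : α × β => g q.1 q.2) :
    Measurable fun a => (κ a).map (g a) := by
  let K : Kernel α β := ⟨κ, hκ⟩
  have : IsMarkovKernel K := ⟨fun a => inferInstanceAs (IsProbabilityMeasure (κ a))⟩
  refine Measure.measurable_measure.2 fun s hs => ?_
  have h := Kernel.measurable_kernel_prodMk_left (κ := K) (hg hs)
  convert h using 2 with a
  have hga : Measurable (g a) := hg.comp measurable_prodMk_left
  rw [Measure.map_apply hga hs]
  rfl

lemma measurable_measure_prod {α β γ : Type*} [MeasurableSpace α] [MeasurableSpace β]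
    [MeasurableSpace γ] {κ : α → Measure β} (hκ : Measurable κ) [∀ a, IsProbabilityMeasure (κ a)]
    {η : α → Measure γ} (hη : Measurable η) [∀ a, IsProbabilityMeasure (η a)] :
    Measurable fun a => (κ a).prod (η a) := by
  let K : Kernel α β := ⟨κ, hκ⟩
  let H : Kernel α γ := ⟨η, hη⟩
  have : IsMarkovKernel K := ⟨fun a => inferInstanceAs (IsProbabilityMeasure (κ a))⟩
  have : IsMarkovKernel H := ⟨fun a => inferInstanceAs (IsProbabilityMeasure (η a))⟩
  convert (K ×ₖ H).measurable using 2 with a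
  rw [Kernel.prod_apply]
  rfl

lemma measurable_measure_sum {α β ι : Type*} [MeasurableSpace α] [MeasurableSpace β] [Fintype ι]
    {κ : ι → α → Measure β} (hκ : ∀ i, Measurable (κ i)) :
    Measurable fun a => Measure.sum fun i => κ i a := by
  refine Measure.measurable_measure.2 fun s hs => ?_
  simp only [Measure.sum_apply _ hs, tsum_fintype]
  exact Finset.measurable_sum _ fun i _ => (Measure.measurable_coe hs).comp (hκ i)

lemma measurable_normalize {α β : Type*} [MeasurableSpace α] [MeasurableSpace β]
    {κ : α → Measure β} (hκ : Measurable κ) : Measurable fun a => normalize (κ a) := by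
  refine Measure.measurable_measure.2 fun s hs => ?_
  simp only [normalize, Measure.smul_apply, smul_eq_mul]
  exact ((Measure.measurable_coe MeasurableSet.univ).comp hκ).inv.mul
    ((Measure.measurable_coe hs).comp hκ)

variable {α : Type*} [MeasurableSpace α]

lemma isProbabilityMeasure_normalize {m : Measure α} (h0 : m Set.univ ≠ 0)
    (h1 : m Set.univ ≠ ⊤) : IsProbabilityMeasure (normalize m) :=
  ⟨by simp [normalize, ENNReal.inv_mul_cancel h0 h1]⟩

lemma integral_normalize (m : Measure α) (f : α → ℝ) :
    ∫ x, f x ∂(normalize m) = (∫ x, f x ∂m) / m.real Set.univ := by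
  rw [normalize, integral_smul_measure, ENNReal.toReal_inv, smul_eq_mul, inv_mul_eq_div]
  rfl

lemma ae_normalize {m : Measure α} {p : α → Prop} (h : ∀ᵐ x ∂m, p x) :
    ∀ᵐ x ∂(normalize m), p x :=
  Measure.ae_smul_measure h _

lemma normalize_univ_le_one (m : Measure α) : normalize m Set.univ ≤ 1 := by
  simp [normalize, ENNReal.inv_mul_le_one]

lemma ae_bind {β : Type*} [MeasurableSpace β] {m : Measure α} {κ : α → Measure β} {p : β → Prop}
    (hp : MeasurableSet {b | p b}) (h : ∀ᵐ a ∂m, ∀ᵐ b ∂κ a, p b) : ∀ᵐ b ∂(m.bind κ), p b := by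
  refine le_antisymm ((Measure.bind_apply_le κ hp.compl).trans_eq ?_) zero_le
  refine (lintegral_congr_ae (g := 0) ?_).trans (by simp)
  filter_upwards [h] with a ha using ha

end Kernels

section Backward

variable {R : ∀ k, Kernel (X k × X (k + 1)) (Z k)}
  {lhat : ∀ k, X k → X (k + 1) → Z k → ℝ} {htil : ∀ k, X k → X (k + 1) → ℝ}
  {N n M : ℕ} {s : PState X N n}

/-- The unnormalised law of one backward draw, restricted to ancestor index `j`. -/
noncomputable def bwdComp (R : ∀ k, Kernel (X k × X (k + 1)) (Z k))
    (lhat : ∀ k, X k → X (k + 1) → Z k → ℝ) (s : PState X N n) (j : Fin N) (x' : X (n + 1)) :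
    Measure (Fin N × Z n) :=
  ((R n ((s j).1, x')).withDensity fun z =>
    ENNReal.ofReal ((s j).2.2 * lhat n (s j).1 x' z)).map fun z => (j, z)

lemma bwdMeas_eq (x' : X (n + 1)) :
    bwdMeas R lhat n s x' = normalize (Measure.sum fun j => bwdComp R lhat s j x') := rfl

/-- The statistic `M⁻¹ ∑_{j<M} (τ^{J_j} + h̃_n(ξ^{J_j}, x'))` as a function of the draws. -/
noncomputable def bsStat (htil : ∀ k, X k → X (k + 1) → ℝ) (M : ℕ) (s : PState X N n)
    (x' : X (n + 1)) (J : Fin M → Fin N × Z n) : ℝ :=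
  (M : ℝ)⁻¹ * ∑ j : Fin M, ((s (J j).1).2.1 + htil n (s (J j).1).1 x')

lemma bsLaw_eq (x' : X (n + 1)) : bsLaw R lhat htil M n s x' =
    (Measure.pi fun _ : Fin M => bwdMeas R lhat n s x').map (bsStat htil M s x') := rfl

variable [∀ k, IsMarkovKernel (R k)]

lemma integrable_lhat
    (hlmeas : ∀ k, Measurable fun q : (X k × X (k + 1)) × Z k => lhat k q.1.1 q.1.2 q.2)
    (hlpos : ∀ k x y z, 0 < lhat k x y z) (hlbdd : ∀ k x y, ∃ C, ∀ z, lhat k x y z ≤ C)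
    (k : ℕ) (x : X k) (y : X (k + 1)) : Integrable (lhat k x y) (R k (x, y)) := by
  obtain ⟨C, hC⟩ := hlbdd k x y
  refine Integrable.of_bound (C := C)
    ((hlmeas k).comp (measurable_prodMk_left (x := (x, y)))).aestronglyMeasurable (ae_of_all _ fun z => ?_)
  rw [Real.norm_of_nonneg (hlpos k x y z).le]
  exact hC z

lemma lEps_pos
    (hlmeas : ∀ k, Measurable fun q : (X k × X (k + 1)) × Z k => lhat k q.1.1 q.1.2 q.2)
    (hlpos : ∀ k x y z, 0 < lhat k x y z) (hlbdd : ∀ k x y, ∃ C, ∀ z, lhat k x y z ≤ C)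
    (k : ℕ) (x : X k) (y : X (k + 1)) : 0 < lEps R lhat k x y := by
  refine (integral_pos_iff_support_of_nonneg (fun z => (hlpos k x y z).le)
    (integrable_lhat hlmeas hlpos hlbdd k x y)).2 ?_
  have : Function.support (lhat k x y) = Set.univ := by
    ext z; simp [(hlpos k x y z).ne']
  simp [this]

lemma measurable_lEps
    (hlmeas : ∀ k, Measurable fun q : (X k × X (k + 1)) × Z k => lhat k q.1.1 q.1.2 q.2) (k : ℕ) :
    Measurable fun q : X k × X (k + 1) => lEps R lhat k q.1 q.2 :=
  ((hlmeas k).stronglyMeasurable.integral_kernel_prod_right' (κ := R k)).measurable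

lemma bwdComp_univ
    (hlmeas : ∀ k, Measurable fun q : (X k × X (k + 1)) × Z k => lhat k q.1.1 q.1.2 q.2)
    (hlpos : ∀ k x y z, 0 < lhat k x y z) (hlbdd : ∀ k x y, ∃ C, ∀ z, lhat k x y z ≤ C)
    (hs : ∀ i, 0 ≤ (s i).2.2) (j : Fin N) (x' : X (n + 1)) :
    bwdComp R lhat s j x' Set.univ = ENNReal.ofReal ((s j).2.2 * lEps R lhat n (s j).1 x') := by
  rw [bwdComp, Measure.map_apply measurable_prodMk_left MeasurableSet.univ, Set.preimage_univ,
    withDensity_apply _ MeasurableSet.univ, Measure.restrict_univ, lEps, ← integral_const_mul,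
    ofReal_integral_eq_lintegral_ofReal]
  · exact (integrable_lhat hlmeas hlpos hlbdd n _ x').const_mul _
  · exact ae_of_all _ fun z => mul_nonneg (hs j) (hlpos _ _ _ _).le

lemma measurable_bwdComp
    (hlmeas : ∀ k, Measurable fun q : (X k × X (k + 1)) × Z k => lhat k q.1.1 q.1.2 q.2)
    (j : Fin N) : Measurable (bwdComp R lhat s j) := by
  let K : Kernel (X (n + 1)) (Z n) := (R n).comap (Prod.mk (s j).1) measurable_prodMk_left
  have hf : Measurable (Function.uncurry fun (y : X (n + 1)) (z : Z n) =>
      ENNReal.ofReal ((s j).2.2 * lhat n (s j).1 y z)) := by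
    have : Measurable fun q : X (n + 1) × Z n => lhat n (s j).1 q.1 q.2 :=
      (hlmeas n).comp (f := fun q : X (n + 1) × Z n => (((s j).1, q.1), q.2)) (by fun_prop)
    exact (this.const_mul _).ennreal_ofReal
  have hj : Measurable (Prod.mk j : Z n → Fin N × Z n) := measurable_prodMk_left
  have h := (Measure.measurable_map _ hj).comp
    (K.withDensity fun y z => ENNReal.ofReal ((s j).2.2 * lhat n (s j).1 y z)).measurable
  refine (funext fun y => ?_ : _ = bwdComp R lhat s j) ▸ h
  rw [Function.comp_apply, Kernel.withDensity_apply K hf]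
  rfl

lemma sum_weight_lEps_pos
    (hlmeas : ∀ k, Measurable fun q : (X k × X (k + 1)) × Z k => lhat k q.1.1 q.1.2 q.2)
    (hlpos : ∀ k x y z, 0 < lhat k x y z) (hlbdd : ∀ k x y, ∃ C, ∀ z, lhat k x y z ≤ C)
    (hs : ∀ i, 0 ≤ (s i).2.2) (hs0 : ∃ i, 0 < (s i).2.2) (x' : X (n + 1)) :
    0 < ∑ j, (s j).2.2 * lEps R lhat n (s j).1 x' := by
  obtain ⟨i, hi⟩ := hs0
  have hl := fun j => lEps_pos (R := R) hlmeas hlpos hlbdd n (s j).1 x'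
  exact Finset.sum_pos' (fun j _ => mul_nonneg (hs j) (hl j).le)
    ⟨i, Finset.mem_univ i, mul_pos hi (hl i)⟩

lemma bwdSum_univ
    (hlmeas : ∀ k, Measurable fun q : (X k × X (k + 1)) × Z k => lhat k q.1.1 q.1.2 q.2)
    (hlpos : ∀ k x y z, 0 < lhat k x y z) (hlbdd : ∀ k x y, ∃ C, ∀ z, lhat k x y z ≤ C)
    (hs : ∀ i, 0 ≤ (s i).2.2) (x' : X (n + 1)) :
    (Measure.sum fun j => bwdComp R lhat s j x') Set.univ =
      ENNReal.ofReal (∑ j, (s j).2.2 * lEps R lhat n (s j).1 x') := by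
  rw [Measure.sum_apply _ MeasurableSet.univ, tsum_fintype, ENNReal.ofReal_sum_of_nonneg]
  · simp only [bwdComp_univ hlmeas hlpos hlbdd hs]
  · exact fun j _ => mul_nonneg (hs j) (lEps_pos hlmeas hlpos hlbdd n _ x').le

lemma isProbabilityMeasure_bwdMeas
    (hlmeas : ∀ k, Measurable fun q : (X k × X (k + 1)) × Z k => lhat k q.1.1 q.1.2 q.2)
    (hlpos : ∀ k x y z, 0 < lhat k x y z) (hlbdd : ∀ k x y, ∃ C, ∀ z, lhat k x y z ≤ C)
    (hs : ∀ i, 0 ≤ (s i).2.2) (hs0 : ∃ i, 0 < (s i).2.2) (x' : X (n + 1)) :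
    IsProbabilityMeasure (bwdMeas R lhat n s x') := by
  rw [bwdMeas_eq]
  have := sum_weight_lEps_pos (R := R) hlmeas hlpos hlbdd hs hs0 x'
  apply isProbabilityMeasure_normalize <;> rw [bwdSum_univ hlmeas hlpos hlbdd hs]
  · simpa using this
  · simp

lemma measurable_bwdMeas
    (hlmeas : ∀ k, Measurable fun q : (X k × X (k + 1)) × Z k => lhat k q.1.1 q.1.2 q.2) :
    Measurable (bwdMeas R lhat n s) :=
  measurable_normalize (measurable_measure_sum fun j => measurable_bwdComp hlmeas j)

lemma integral_bwdMeas
    (hlmeas : ∀ k, Measurable fun q : (X k × X (k + 1)) × Z k => lhat k q.1.1 q.1.2 q.2)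
    (hlpos : ∀ k x y z, 0 < lhat k x y z) (hlbdd : ∀ k x y, ∃ C, ∀ z, lhat k x y z ≤ C)
    (hs : ∀ i, 0 ≤ (s i).2.2) (x' : X (n + 1)) (F : Fin N → ℝ) :
    ∫ J, F J.1 ∂(bwdMeas R lhat n s x') =
      (∑ j, (s j).2.2 * lEps R lhat n (s j).1 x' * F j) /
        ∑ j, (s j).2.2 * lEps R lhat n (s j).1 x' := by
  have hnn : ∀ j, 0 ≤ (s j).2.2 * lEps R lhat n (s j).1 x' := fun j =>
    mul_nonneg (hs j) (lEps_pos hlmeas hlpos hlbdd n _ x').le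
  have hF : Measurable fun J : Fin N × Z n => F J.1 :=
    (measurable_of_finite F).comp measurable_fst
  have hcomp (j : Fin N) : ∫ J, F J.1 ∂(bwdComp R lhat s j x') =
      (s j).2.2 * lEps R lhat n (s j).1 x' * F j := by
    have hu := bwdComp_univ (R := R) hlmeas hlpos hlbdd hs j x'
    rw [bwdComp, Measure.map_apply measurable_prodMk_left MeasurableSet.univ,
      Set.preimage_univ] at hu
    rw [bwdComp, integral_map measurable_prodMk_left.aemeasurable hF.aestronglyMeasurable]
    dsimp only
    rw [integral_const, Measure.real, hu, ENNReal.toReal_ofReal (hnn j), smul_eq_mul]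
  have hfin (j : Fin N) : IsFiniteMeasure (bwdComp R lhat s j x') :=
    ⟨by rw [bwdComp_univ hlmeas hlpos hlbdd hs]; exact ENNReal.ofReal_lt_top⟩
  rw [bwdMeas_eq, integral_normalize, Measure.real, bwdSum_univ hlmeas hlpos hlbdd hs,
    ENNReal.toReal_ofReal (Finset.sum_nonneg fun j _ => hnn j), Measure.sum_fintype,
    integral_finsetSum_measure]
  · simp only [hcomp]
  · intro j _
    obtain ⟨C, hC⟩ := (Set.finite_range fun j => ‖F j‖).bddAbove
    exact Integrable.of_bound hF.aestronglyMeasurable C (ae_of_all _ fun J => hC ⟨J.1, rfl⟩)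

lemma measurable_bsStat
    (hhmeas : ∀ k, Measurable fun q : X k × X (k + 1) => htil k q.1 q.2) :
    Measurable fun q : X (n + 1) × (Fin M → Fin N × Z n) => bsStat htil M s q.1 q.2 := by
  unfold bsStat
  refine (Finset.measurable_sum _ fun j _ => ?_).const_mul _
  have h : Measurable fun r : X (n + 1) × Fin N => (s r.2).2.1 + htil n (s r.2).1 r.1 :=
    measurable_from_prod_countable_left fun i =>
      ((hhmeas n).comp (measurable_prodMk_left (x := (s i).1))).const_add (s i).2.1
  exact h.comp (f := fun q : X (n + 1) × (Fin M → Fin N × Z n) => (q.1, (q.2 j).1)) (by fun_prop)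

lemma measurable_bsStat_right
    (hhmeas : ∀ k, Measurable fun q : X k × X (k + 1) => htil k q.1 q.2) (x' : X (n + 1)) :
    Measurable (bsStat htil M s x' : (Fin M → Fin N × Z n) → ℝ) :=
  (measurable_bsStat hhmeas).comp measurable_prodMk_left

omit [∀ n, MeasurableSpace (X n)] [∀ n, MeasurableSpace (Z n)] in
lemma abs_bsStat_le {Cτ Ch : ℝ} (hτ : ∀ i, |(s i).2.1| ≤ Cτ) (hh : ∀ x y, |htil n x y| ≤ Ch)
    (hM : 1 ≤ M) (x' : X (n + 1)) (J : Fin M → Fin N × Z n) :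
    |bsStat htil M s x' J| ≤ Cτ + Ch := by
  have hM0 : (0 : ℝ) < M := by exact_mod_cast hM
  have h : |∑ j : Fin M, ((s (J j).1).2.1 + htil n (s (J j).1).1 x')| ≤ M * (Cτ + Ch) := by
    refine (Finset.abs_sum_le_sum_abs _ _).trans ?_
    refine (Finset.sum_le_card_nsmul _ _ (Cτ + Ch) fun j _ => ?_).trans_eq (by simp [mul_add])
    exact (abs_add_le _ _).trans (add_le_add (hτ _) (hh _ _))
  rw [bsStat, abs_mul, abs_of_pos (inv_pos.2 hM0), inv_mul_le_iff₀ hM0]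
  exact h

lemma isProbabilityMeasure_bsLaw
    (hlmeas : ∀ k, Measurable fun q : (X k × X (k + 1)) × Z k => lhat k q.1.1 q.1.2 q.2)
    (hlpos : ∀ k x y z, 0 < lhat k x y z) (hlbdd : ∀ k x y, ∃ C, ∀ z, lhat k x y z ≤ C)
    (hhmeas : ∀ k, Measurable fun q : X k × X (k + 1) => htil k q.1 q.2)
    (hs : ∀ i, 0 ≤ (s i).2.2) (hs0 : ∃ i, 0 < (s i).2.2) (x' : X (n + 1)) :
    IsProbabilityMeasure (bsLaw R lhat htil M n s x') := by
  have := isProbabilityMeasure_bwdMeas (R := R) hlmeas hlpos hlbdd hs hs0 x'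
  rw [bsLaw_eq]
  exact Measure.isProbabilityMeasure_map
    (measurable_bsStat_right hhmeas x').aemeasurable

lemma measurable_bsLaw
    (hlmeas : ∀ k, Measurable fun q : (X k × X (k + 1)) × Z k => lhat k q.1.1 q.1.2 q.2)
    (hlpos : ∀ k x y z, 0 < lhat k x y z) (hlbdd : ∀ k x y, ∃ C, ∀ z, lhat k x y z ≤ C)
    (hhmeas : ∀ k, Measurable fun q : X k × X (k + 1) => htil k q.1 q.2)
    (hs : ∀ i, 0 ≤ (s i).2.2) (hs0 : ∃ i, 0 < (s i).2.2) :
    Measurable (bsLaw R lhat htil M n s) := by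
  have := isProbabilityMeasure_bwdMeas (R := R) hlmeas hlpos hlbdd hs hs0
  exact measurable_map_uncurry (measurable_measure_pi (measurable_bwdMeas hlmeas))
    (measurable_bsStat hhmeas)

omit [∀ k, IsMarkovKernel (R k)] in
lemma ae_bsLaw_le {Cτ Ch : ℝ} (hτ : ∀ i, |(s i).2.1| ≤ Cτ) (hh : ∀ x y, |htil n x y| ≤ Ch)
    (hhmeas : ∀ k, Measurable fun q : X k × X (k + 1) => htil k q.1 q.2)
    (hM : 1 ≤ M) (x' : X (n + 1)) : ∀ᵐ t ∂(bsLaw R lhat htil M n s x'), |t| ≤ Cτ + Ch := by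
  rw [bsLaw_eq, ae_map_iff (measurable_bsStat_right hhmeas x').aemeasurable
    (measurableSet_le (continuous_abs.measurable (α := ℝ)) measurable_const)]
  exact ae_of_all _ fun J => abs_bsStat_le hτ hh hM x' J

lemma integral_bsLaw
    (hlmeas : ∀ k, Measurable fun q : (X k × X (k + 1)) × Z k => lhat k q.1.1 q.1.2 q.2)
    (hlpos : ∀ k x y z, 0 < lhat k x y z) (hlbdd : ∀ k x y, ∃ C, ∀ z, lhat k x y z ≤ C)
    (hhmeas : ∀ k, Measurable fun q : X k × X (k + 1) => htil k q.1 q.2)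
    (hs : ∀ i, 0 ≤ (s i).2.2) (hs0 : ∃ i, 0 < (s i).2.2) (hM : 1 ≤ M) (x' : X (n + 1)) :
    ∫ t, t ∂(bsLaw R lhat htil M n s x') =
      (∑ j, (s j).2.2 * lEps R lhat n (s j).1 x' * ((s j).2.1 + htil n (s j).1 x')) /
        ∑ j, (s j).2.2 * lEps R lhat n (s j).1 x' := by
  have hM0 : (M : ℝ) ≠ 0 := by positivity
  have := isProbabilityMeasure_bwdMeas (R := R) hlmeas hlpos hlbdd hs hs0 x'
  let F : Fin N → ℝ := fun j => (s j).2.1 + htil n (s j).1 x'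
  have hF : Measurable fun J : Fin N × Z n => F J.1 :=
    (measurable_of_finite F).comp measurable_fst
  have hFi : Integrable (fun J : Fin N × Z n => F J.1) (bwdMeas R lhat n s x') := by
    obtain ⟨C, hC⟩ := (Set.finite_range fun j => ‖F j‖).bddAbove
    exact Integrable.of_bound hF.aestronglyMeasurable C (ae_of_all _ fun J => hC ⟨J.1, rfl⟩)
  rw [bsLaw_eq, integral_map
    (measurable_bsStat_right hhmeas x').aemeasurable (by fun_prop)]
  have e (j : Fin M) : ∫ J, F (J j).1 ∂(Measure.pi fun _ : Fin M => bwdMeas R lhat n s x') =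
      ∫ J, F J.1 ∂(bwdMeas R lhat n s x') :=
    integral_comp_eval (μ := fun _ : Fin M => bwdMeas R lhat n s x') (i := j)
      hF.aestronglyMeasurable
  have ei (j : Fin M) : Integrable (fun J : Fin M → Fin N × Z n => F (J j).1)
      (Measure.pi fun _ : Fin M => bwdMeas R lhat n s x') :=
    integrable_comp_eval (μ := fun _ : Fin M => bwdMeas R lhat n s x') (i := j) hFi
  change ∫ J : Fin M → Fin N × Z n, (M : ℝ)⁻¹ * ∑ j : Fin M, F (J j).1 ∂_ = _
  rw [integral_const_mul, integral_finsetSum _ fun j _ => ei j]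
  simp only [e, Finset.sum_const, Finset.card_univ, Fintype.card_fin, nsmul_eq_mul]
  rw [inv_mul_cancel_left₀ hM0]
  exact integral_bwdMeas hlmeas hlpos hlbdd hs x' F

end Backward

section Particle

/-- Positivity, measurability and boundedness of the ingredients of the particle update. -/
structure Regular (μ : ∀ n, Measure (X n)) (R : ∀ k, Kernel (X k × X (k + 1)) (Z k))
    (lhat : ∀ k, X k → X (k + 1) → Z k → ℝ) (htil : ∀ k, X k → X (k + 1) → ℝ)
    (ϑ : ∀ k, X k → ℝ) (pr : ∀ k, X k → X (k + 1) → ℝ) : Prop where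
  lhat_meas : ∀ k, Measurable fun q : (X k × X (k + 1)) × Z k => lhat k q.1.1 q.1.2 q.2
  lhat_pos : ∀ k x y z, 0 < lhat k x y z
  adj_meas : ∀ k, Measurable (ϑ k)
  adj_pos : ∀ k x, 0 < ϑ k x
  adj_bdd : ∀ k, ∃ C, ∀ x, ϑ k x ≤ C
  pr_meas : ∀ k, Measurable fun q : X k × X (k + 1) => pr k q.1 q.2
  pr_pos : ∀ k x y, 0 < pr k x y
  pr_markov : ∀ k x, ∫⁻ y, ENNReal.ofReal (pr k x y) ∂μ (k + 1) = 1
  weight_bdd : ∃ C, ∀ k (x : X k) y z, lhat k x y z / (ϑ k x * pr k x y) ≤ C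
  htil_meas : ∀ k, Measurable fun q : X k × X (k + 1) => htil k q.1 q.2
  htil_bdd : ∀ k, ∃ C, ∀ x y, |htil k x y| ≤ C

namespace Regular

variable {μ : ∀ n, Measure (X n)} {R : ∀ k, Kernel (X k × X (k + 1)) (Z k)}
  {lhat : ∀ k, X k → X (k + 1) → Z k → ℝ} {htil : ∀ k, X k → X (k + 1) → ℝ}
  {ϑ : ∀ k, X k → ℝ} {pr : ∀ k, X k → X (k + 1) → ℝ}
  (H : Regular μ R lhat htil ϑ pr)
include H

lemma adj_pr_pos (k : ℕ) (x : X k) (y : X (k + 1)) : 0 < ϑ k x * pr k x y :=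
  mul_pos (H.adj_pos k x) (H.pr_pos k x y)

lemma exists_weight_bound : ∃ C, 0 < C ∧ ∀ k (x : X k) y z, lhat k x y z ≤
      C * (ϑ k x * pr k x y) := by
  obtain ⟨C, hC⟩ := H.weight_bdd
  refine ⟨max C 1, by positivity, fun k x y z => ?_⟩
  rw [← div_le_iff₀ (H.adj_pr_pos k x y)]
  exact (hC k x y z).trans (le_max_left _ _)

lemma lhat_bdd (k : ℕ) (x : X k) (y : X (k + 1)) : ∃ C, ∀ z, lhat k x y z ≤ C := by
  obtain ⟨C, -, hC⟩ := H.exists_weight_bound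
  exact ⟨_, hC k x y⟩

lemma integral_pr (k : ℕ) (x : X k) : ∫ y, pr k x y ∂μ (k + 1) = 1 := by
  rw [integral_eq_lintegral_of_nonneg_ae (ae_of_all _ fun y => (H.pr_pos k x y).le)
    ((H.pr_meas k).comp measurable_prodMk_left).aestronglyMeasurable, H.pr_markov]
  simp

lemma integrable_pr (k : ℕ) (x : X k) : Integrable (pr k x) (μ (k + 1)) :=
  integrable_of_integral_eq_one (H.integral_pr k x)

lemma isProbabilityMeasure_proposal (k : ℕ) (x : X k) :
    IsProbabilityMeasure ((μ (k + 1)).withDensity fun y => ENNReal.ofReal (pr k x y)) :=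
  ⟨by rw [withDensity_apply _ MeasurableSet.univ, Measure.restrict_univ, H.pr_markov]⟩

lemma integral_proposal (k : ℕ) (x : X k) (f : X (k + 1) → ℝ) :
    ∫ y, f y ∂((μ (k + 1)).withDensity fun y => ENNReal.ofReal (pr k x y)) =
      ∫ y, pr k x y * f y ∂μ (k + 1) := by
  have hp : Measurable (pr k x) := (H.pr_meas k).comp measurable_prodMk_left
  rw [integral_withDensity_eq_integral_toReal_smul hp.ennreal_ofReal (by simp)]
  exact integral_congr_ae (ae_of_all _ fun y => by
    simp [ENNReal.toReal_ofReal (H.pr_pos k x y).le])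

lemma measurable_weight (n : ℕ) : Measurable fun q : (X n × X (n + 1)) × Z n =>
    lhat n q.1.1 q.1.2 q.2 / (ϑ n q.1.1 * pr n q.1.1 q.1.2) :=
  (H.lhat_meas n).div (((H.adj_meas n).comp (measurable_fst.comp measurable_fst)).mul
    ((H.pr_meas n).comp measurable_fst))

lemma measurable_weight_right {n : ℕ} (x : X n) (y : X (n + 1)) :
    Measurable fun z => lhat n x y z / (ϑ n x * pr n x y) :=
  (H.measurable_weight n).comp (f := fun z => ((x, y), z)) measurable_prodMk_left

variable [∀ k, IsMarkovKernel (R k)]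

lemma lEps_pos (k : ℕ) (x : X k) (y : X (k + 1)) : 0 < lEps R lhat k x y :=
  PmParis.lEps_pos H.lhat_meas H.lhat_pos H.lhat_bdd k x y

lemma exists_lEps_bound :
    ∃ C, 0 < C ∧ ∀ k (x : X k) y, lEps R lhat k x y ≤ C * (ϑ k x * pr k x y) := by
  obtain ⟨C, hC0, hC⟩ := H.exists_weight_bound
  refine ⟨C, hC0, fun k x y => ?_⟩
  refine (integral_mono (integrable_lhat H.lhat_meas H.lhat_pos H.lhat_bdd k x y)
    (integrable_const _) (hC k x y)).trans_eq ?_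
  simp

lemma measurable_lEps_right (k : ℕ) (x : X k) : Measurable (lEps R lhat k x) :=
  (measurable_lEps H.lhat_meas k).comp measurable_prodMk_left

lemma integrable_lEps_mul (k : ℕ) (x : X k) {f : X (k + 1) → ℝ} (hf : Measurable f) {C : ℝ}
    (hC : ∀ y, |f y| ≤ C) : Integrable (fun y => lEps R lhat k x y * f y) (μ (k + 1)) := by
  obtain ⟨D, hD0, hD⟩ := H.exists_lEps_bound
  refine Integrable.mul_bdd (c := C) ?_ hf.aestronglyMeasurable (ae_of_all _ hC)
  refine ((H.integrable_pr k x).const_mul (D * ϑ k x)).mono'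
    (H.measurable_lEps_right k x).aestronglyMeasurable (ae_of_all _ fun y => ?_)
  rw [Real.norm_of_nonneg (H.lEps_pos k x y).le, mul_assoc]
  exact hD k x y

end Regular

/-- Law of `(ξ', τ', ω')` given the proposed position `y` and the ancestor position `x`. -/
noncomputable def partKernel (R : ∀ k, Kernel (X k × X (k + 1)) (Z k))
    (lhat : ∀ k, X k → X (k + 1) → Z k → ℝ) (htil : ∀ k, X k → X (k + 1) → ℝ)
    (ϑ : ∀ k, X k → ℝ) (pr : ∀ k, X k → X (k + 1) → ℝ) {N n : ℕ} (M : ℕ) (s : PState X N n)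
    (x : X n) (y : X (n + 1)) : Measure (X (n + 1) × ℝ × ℝ) :=
  ((bsLaw R lhat htil M n s y).prod
    ((R n (x, y)).map fun z => lhat n x y z / (ϑ n x * pr n x y))).map fun q => (y, q.1, q.2)

/-- Law of `(ξ', τ', ω')` given the ancestor position `x`. -/
noncomputable def ancestorLaw (μ : ∀ n, Measure (X n)) (R : ∀ k, Kernel (X k × X (k + 1)) (Z k))
    (lhat : ∀ k, X k → X (k + 1) → Z k → ℝ) (htil : ∀ k, X k → X (k + 1) → ℝ)
    (ϑ : ∀ k, X k → ℝ) (pr : ∀ k, X k → X (k + 1) → ℝ) {N n : ℕ} (M : ℕ) (s : PState X N n)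
    (x : X n) : Measure (X (n + 1) × ℝ × ℝ) :=
  ((μ (n + 1)).withDensity fun y => ENNReal.ofReal (pr n x y)).bind
    (partKernel R lhat htil ϑ pr M s x)

lemma partLaw_eq (μ : ∀ n, Measure (X n)) (R : ∀ k, Kernel (X k × X (k + 1)) (Z k))
    (lhat : ∀ k, X k → X (k + 1) → Z k → ℝ) (htil : ∀ k, X k → X (k + 1) → ℝ)
    (ϑ : ∀ k, X k → ℝ) (pr : ∀ k, X k → X (k + 1) → ℝ) {N n : ℕ} (M : ℕ) (s : PState X N n) :
    partLaw μ R lhat htil ϑ pr M n s = normalize (Measure.sum fun I : Fin N =>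
      ENNReal.ofReal (ϑ n (s I).1 * (s I).2.2) •
        ancestorLaw μ R lhat htil ϑ pr M s (s I).1) := rfl

lemma abs_update_le {α : Type*} {Cτ Cw Cf Cg : ℝ} {f g : α → ℝ}
    (hfC : ∀ y, |f y| ≤ Cf) (hgC : ∀ y, |g y| ≤ Cg) {q : α × ℝ × ℝ}
    (hq : |q.2.1| ≤ Cτ ∧ 0 ≤ q.2.2 ∧ q.2.2 ≤ Cw) :
    |q.2.2 * (q.2.1 * f q.1 + g q.1)| ≤ Cw * (Cτ * Cf + Cg) := by
  obtain ⟨h1, h2, h3⟩ := hq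
  rw [abs_mul, abs_of_nonneg h2]
  have : |q.2.1 * f q.1 + g q.1| ≤ Cτ * Cf + Cg := by
    refine (abs_add_le _ _).trans (add_le_add ?_ (hgC _))
    rw [abs_mul]
    exact mul_le_mul h1 (hfC _) (abs_nonneg _) ((abs_nonneg _).trans h1)
  exact mul_le_mul h3 this (abs_nonneg _) (h2.trans h3)

lemma measurableSet_stat_weight {α : Type*} [MeasurableSpace α] (A B : ℝ) :
    MeasurableSet {q : α × ℝ × ℝ | |q.2.1| ≤ A ∧ 0 ≤ q.2.2 ∧ q.2.2 ≤ B} := by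
  have h1 : Measurable fun q : α × ℝ × ℝ => |q.2.1| :=
    (continuous_abs.measurable (α := ℝ)).comp (by fun_prop)
  have h2 : Measurable fun q : α × ℝ × ℝ => q.2.2 := by fun_prop
  exact (measurableSet_le h1 measurable_const).inter
    ((measurableSet_le measurable_const h2).inter (measurableSet_le h2 measurable_const))

namespace Regular

variable {μ : ∀ n, Measure (X n)} {R : ∀ k, Kernel (X k × X (k + 1)) (Z k)}
  [∀ k, IsMarkovKernel (R k)]
  {lhat : ∀ k, X k → X (k + 1) → Z k → ℝ} {htil : ∀ k, X k → X (k + 1) → ℝ}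
  {ϑ : ∀ k, X k → ℝ} {pr : ∀ k, X k → X (k + 1) → ℝ}
  (H : Regular μ R lhat htil ϑ pr) {N n M : ℕ} {s : PState X N n}
include H

lemma isProbabilityMeasure_map_weight (x : X n) (y : X (n + 1)) : IsProbabilityMeasure
    ((R n (x, y)).map fun z => lhat n x y z / (ϑ n x * pr n x y)) :=
  Measure.isProbabilityMeasure_map (H.measurable_weight_right x y).aemeasurable

omit [∀ k, IsMarkovKernel (R k)] in
lemma integral_map_weight (x : X n) (y : X (n + 1)) :
    ∫ w, w ∂((R n (x, y)).map fun z => lhat n x y z / (ϑ n x * pr n x y)) =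
      lEps R lhat n x y / (ϑ n x * pr n x y) := by
  rw [integral_map (H.measurable_weight_right x y).aemeasurable (by fun_prop), integral_div]
  rfl

lemma isProbabilityMeasure_partKernel (hs : ∀ i, 0 ≤ (s i).2.2) (hs0 : ∃ i, 0 < (s i).2.2)
    (x : X n) (y : X (n + 1)) :
    IsProbabilityMeasure (partKernel R lhat htil ϑ pr M s x y) := by
  have := isProbabilityMeasure_bsLaw (R := R) (M := M) H.lhat_meas H.lhat_pos H.lhat_bdd
    H.htil_meas hs hs0 y
  have := H.isProbabilityMeasure_map_weight x y
  exact Measure.isProbabilityMeasure_map (by fun_prop)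

lemma measurable_partKernel (hs : ∀ i, 0 ≤ (s i).2.2) (hs0 : ∃ i, 0 < (s i).2.2) (x : X n) :
    Measurable (partKernel R lhat htil ϑ pr M s x) := by
  have h1 := isProbabilityMeasure_bsLaw (R := R) (M := M) H.lhat_meas H.lhat_pos H.lhat_bdd
    H.htil_meas hs hs0
  have h2 := H.isProbabilityMeasure_map_weight x
  have m1 := measurable_bsLaw (R := R) (M := M) H.lhat_meas H.lhat_pos H.lhat_bdd
    H.htil_meas hs hs0
  have m2 : Measurable fun y => (R n (x, y)).map fun z => lhat n x y z / (ϑ n x * pr n x y) :=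
    measurable_map_uncurry (κ := fun y => R n (x, y))
      ((R n).measurable.comp measurable_prodMk_left)
      ((H.measurable_weight n).comp (f := fun q : X (n + 1) × Z n => ((x, q.1), q.2))
        (by fun_prop))
  exact measurable_map_uncurry (measurable_measure_prod m1 m2) (by fun_prop)

lemma ae_partKernel {Cτ Ch Cw : ℝ} (hτ : ∀ i, |(s i).2.1| ≤ Cτ) (hh : ∀ x y, |htil n x y| ≤ Ch)
    (hw : ∀ (x : X n) y z, lhat n x y z ≤ Cw * (ϑ n x * pr n x y)) (hM : 1 ≤ M)
    (x : X n) (y : X (n + 1)) : ∀ᵐ q ∂(partKernel R lhat htil ϑ pr M s x y),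
      |q.2.1| ≤ Cτ + Ch ∧ 0 ≤ q.2.2 ∧ q.2.2 ≤ Cw := by
  have := H.isProbabilityMeasure_map_weight x y
  rw [partKernel, ae_map_iff (by fun_prop) (measurableSet_stat_weight _ _)]
  have h1 := Measure.quasiMeasurePreserving_fst
    (ν := (R n (x, y)).map fun z => lhat n x y z / (ϑ n x * pr n x y)) |>.ae
    (ae_bsLaw_le (R := R) (lhat := lhat) hτ hh H.htil_meas hM y)
  have h2 : ∀ᵐ w ∂((R n (x, y)).map fun z => lhat n x y z / (ϑ n x * pr n x y)),
      0 ≤ w ∧ w ≤ Cw := by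
    rw [ae_map_iff (H.measurable_weight_right x y).aemeasurable measurableSet_Icc]
    refine ae_of_all _ fun z => ⟨?_, ?_⟩
    · exact div_nonneg (H.lhat_pos n x y z).le (H.adj_pr_pos n x y).le
    · exact (div_le_iff₀ (H.adj_pr_pos n x y)).2 (hw x y z)
  have h3 := Measure.quasiMeasurePreserving_snd (μ := bsLaw R lhat htil M n s y) |>.ae h2
  filter_upwards [h1, h3] with q hq1 hq2 using ⟨hq1, hq2⟩

lemma integral_partKernel {Cτ : ℝ} (hτ : ∀ i, |(s i).2.1| ≤ Cτ) (hs : ∀ i, 0 ≤ (s i).2.2)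
    (hs0 : ∃ i, 0 < (s i).2.2) (hM : 1 ≤ M) {f g : X (n + 1) → ℝ} (hf : Measurable f)
    (hg : Measurable g) (x : X n) (y : X (n + 1)) :
    ∫ q, q.2.2 * (q.2.1 * f q.1 + g q.1) ∂(partKernel R lhat htil ϑ pr M s x y) =
      ((∫ t, t ∂(bsLaw R lhat htil M n s y)) * f y + g y) *
        (lEps R lhat n x y / (ϑ n x * pr n x y)) := by
  have := isProbabilityMeasure_bsLaw (R := R) (M := M) H.lhat_meas H.lhat_pos H.lhat_bdd
    H.htil_meas hs hs0 y
  have := H.isProbabilityMeasure_map_weight x y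
  obtain ⟨Ch, hh⟩ := H.htil_bdd n
  have hid : Integrable (fun t => t) (bsLaw R lhat htil M n s y) :=
    Integrable.of_bound (by fun_prop) (Cτ + Ch) (ae_bsLaw_le hτ hh H.htil_meas hM y)
  rw [partKernel, integral_map (by fun_prop) (by fun_prop), ← H.integral_map_weight x y]
  have e : ∫ t, (t * f y + g y) ∂(bsLaw R lhat htil M n s y) =
      (∫ t, t ∂(bsLaw R lhat htil M n s y)) * f y + g y := by
    rw [integral_add (hid.mul_const _) (integrable_const _), integral_mul_const]
    simp
  rw [← e, ← integral_prod_mul]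
  exact integral_congr_ae (ae_of_all _ fun q => mul_comm _ _)

lemma isProbabilityMeasure_ancestorLaw (hs : ∀ i, 0 ≤ (s i).2.2) (hs0 : ∃ i, 0 < (s i).2.2)
    (x : X n) : IsProbabilityMeasure (ancestorLaw μ R lhat htil ϑ pr M s x) := by
  have := H.isProbabilityMeasure_proposal n x
  have := H.isProbabilityMeasure_partKernel (M := M) hs hs0 x
  exact isProbabilityMeasure_bind (H.measurable_partKernel hs hs0 x).aemeasurable
    (ae_of_all _ this)

lemma ae_ancestorLaw {Cτ Ch Cw : ℝ} (hτ : ∀ i, |(s i).2.1| ≤ Cτ) (hh : ∀ x y, |htil n x y| ≤ Ch)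
    (hw : ∀ (x : X n) y z, lhat n x y z ≤ Cw * (ϑ n x * pr n x y)) (hM : 1 ≤ M)
    (x : X n) : ∀ᵐ q ∂(ancestorLaw μ R lhat htil ϑ pr M s x),
      |q.2.1| ≤ Cτ + Ch ∧ 0 ≤ q.2.2 ∧ q.2.2 ≤ Cw :=
  ae_bind (measurableSet_stat_weight _ _) (ae_of_all _ fun y => H.ae_partKernel hτ hh hw hM x y)

lemma ae_partLaw {Cτ Ch Cw : ℝ} (hτ : ∀ i, |(s i).2.1| ≤ Cτ) (hh : ∀ x y, |htil n x y| ≤ Ch)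
    (hw : ∀ (x : X n) y z, lhat n x y z ≤ Cw * (ϑ n x * pr n x y)) (hM : 1 ≤ M) :
    ∀ᵐ q ∂(partLaw μ R lhat htil ϑ pr M n s),
      |q.2.1| ≤ Cτ + Ch ∧ 0 ≤ q.2.2 ∧ q.2.2 ≤ Cw := by
  rw [partLaw_eq]
  refine ae_normalize (Measure.ae_sum_iff.2 fun I => ?_)
  exact Measure.ae_smul_measure (H.ae_ancestorLaw hτ hh hw hM _) _

omit [∀ k, IsMarkovKernel (R k)] in
lemma sum_adj_pos (hs : ∀ i, 0 ≤ (s i).2.2) (hs0 : ∃ i, 0 < (s i).2.2) :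
    0 < ∑ i, ϑ n (s i).1 * (s i).2.2 := by
  obtain ⟨i, hi⟩ := hs0
  exact Finset.sum_pos' (fun j _ => mul_nonneg (H.adj_pos n _).le (hs j))
    ⟨i, Finset.mem_univ i, mul_pos (H.adj_pos n _) hi⟩

lemma ancestorSum_univ (hs : ∀ i, 0 ≤ (s i).2.2) (hs0 : ∃ i, 0 < (s i).2.2) :
    (Measure.sum fun I : Fin N => ENNReal.ofReal (ϑ n (s I).1 * (s I).2.2) •
      ancestorLaw μ R lhat htil ϑ pr M s (s I).1) Set.univ =
      ENNReal.ofReal (∑ i, ϑ n (s i).1 * (s i).2.2) := by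
  have := H.isProbabilityMeasure_ancestorLaw (M := M) hs hs0
  rw [Measure.sum_apply _ MeasurableSet.univ, tsum_fintype, ENNReal.ofReal_sum_of_nonneg]
  · simp
  · exact fun j _ => mul_nonneg (H.adj_pos n _).le (hs j)

lemma isProbabilityMeasure_partLaw (hs : ∀ i, 0 ≤ (s i).2.2) (hs0 : ∃ i, 0 < (s i).2.2) :
    IsProbabilityMeasure (partLaw μ R lhat htil ϑ pr M n s) := by
  have := H.sum_adj_pos hs hs0
  rw [partLaw_eq]
  apply isProbabilityMeasure_normalize <;> rw [H.ancestorSum_univ hs hs0]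
  · simpa using this
  · simp

lemma integral_ancestorLaw {Cτ : ℝ} (hτ : ∀ i, |(s i).2.1| ≤ Cτ) (hs : ∀ i, 0 ≤ (s i).2.2)
    (hs0 : ∃ i, 0 < (s i).2.2) (hM : 1 ≤ M) {f g : X (n + 1) → ℝ} {Cf Cg : ℝ} (hf : Measurable f)
    (hfC : ∀ y, |f y| ≤ Cf) (hg : Measurable g) (hgC : ∀ y, |g y| ≤ Cg) (x : X n) :
    ϑ n x * ∫ q, q.2.2 * (q.2.1 * f q.1 + g q.1) ∂(ancestorLaw μ R lhat htil ϑ pr M s x) =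
      ∫ y, lEps R lhat n x y *
        ((∫ t, t ∂(bsLaw R lhat htil M n s y)) * f y + g y) ∂μ (n + 1) := by
  obtain ⟨Ch, hh⟩ := H.htil_bdd n
  obtain ⟨Cw, -, hw⟩ := H.exists_weight_bound
  have := H.isProbabilityMeasure_proposal n x
  have := H.isProbabilityMeasure_partKernel (M := M) hs hs0 x
  have hae : ∀ᵐ q ∂(ancestorLaw μ R lhat htil ϑ pr M s x),
      |q.2.2 * (q.2.1 * f q.1 + g q.1)| ≤ Cw * ((Cτ + Ch) * Cf + Cg) := by
    filter_upwards [H.ae_ancestorLaw (M := M) hτ hh (hw n) hM x] with q hq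
    exact abs_update_le hfC hgC hq
  rw [ancestorLaw, integral_bind_of_bounded (H.measurable_partKernel hs hs0 x) (by fun_prop) hae,
    H.integral_proposal, ← integral_const_mul]
  refine integral_congr_ae (ae_of_all _ fun y => ?_)
  have h1 := (H.adj_pos n x).ne'
  have h2 := (H.pr_pos n x y).ne'
  simp only [H.integral_partKernel hτ hs hs0 hM hf hg]
  field_simp

lemma integral_partLaw {Cτ : ℝ} (hτ : ∀ i, |(s i).2.1| ≤ Cτ) (hs : ∀ i, 0 ≤ (s i).2.2)
    (hs0 : ∃ i, 0 < (s i).2.2) (hM : 1 ≤ M) {f g : X (n + 1) → ℝ} {Cf Cg : ℝ} (hf : Measurable f)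
    (hfC : ∀ y, |f y| ≤ Cf) (hg : Measurable g) (hgC : ∀ y, |g y| ≤ Cg) :
    ∫ q, q.2.2 * (q.2.1 * f q.1 + g q.1) ∂(partLaw μ R lhat htil ϑ pr M n s) =
      (∑ i, (s i).2.2 * ((s i).2.1 * Lop μ (lEps R lhat) n f (s i).1 +
        Lop μ (lEps R lhat) n (fun y => htil n (s i).1 y * f y + g y) (s i).1)) /
      ∑ i, (s i).2.2 * ϑ n (s i).1 := by
  obtain ⟨Ch, hh⟩ := H.htil_bdd n
  obtain ⟨Cw, -, hw⟩ := H.exists_weight_bound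
  have hprob := H.isProbabilityMeasure_ancestorLaw (M := M) hs hs0
  set T : X (n + 1) → ℝ := fun y => ∫ t, t ∂(bsLaw R lhat htil M n s y) with hT
  have hTb : ∀ y, |T y| ≤ Cτ + Ch := by
    intro y
    have := isProbabilityMeasure_bsLaw (R := R) (M := M) H.lhat_meas H.lhat_pos H.lhat_bdd
      H.htil_meas hs hs0 y
    simpa using norm_integral_le_of_norm_le_const (f := fun t => t)
      (ae_bsLaw_le (R := R) (lhat := lhat) hτ hh H.htil_meas hM y)
  have hTm : Measurable T := by
    have : T = fun y => (∑ j, (s j).2.2 * lEps R lhat n (s j).1 y *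
        ((s j).2.1 + htil n (s j).1 y)) / ∑ j, (s j).2.2 * lEps R lhat n (s j).1 y :=
      funext fun y => integral_bsLaw H.lhat_meas H.lhat_pos H.lhat_bdd H.htil_meas hs hs0 hM y
    have hl := fun j => H.measurable_lEps_right n (s j).1
    have hm : ∀ j, Measurable (htil n (s j).1) := fun j =>
      (H.htil_meas n).comp measurable_prodMk_left
    rw [this]
    fun_prop
  have hTfm : Measurable fun y => T y * f y + g y := by fun_prop
  have hTfb : ∀ y, |T y * f y + g y| ≤ (Cτ + Ch) * Cf + Cg := fun y => by
    refine (abs_add_le _ _).trans (add_le_add ?_ (hgC _))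
    rw [abs_mul]
    exact mul_le_mul (hTb y) (hfC _) (abs_nonneg _) ((abs_nonneg _).trans (hTb y))
  have hhm (x : X n) : Measurable fun y => htil n x y * f y + g y :=
    (((H.htil_meas n).comp measurable_prodMk_left).mul hf).add hg
  have hhb (x : X n) (y : X (n + 1)) : |htil n x y * f y + g y| ≤ Ch * Cf + Cg := by
    refine (abs_add_le _ _).trans (add_le_add ?_ (hgC _))
    rw [abs_mul]
    exact mul_le_mul (hh x y) (hfC _) (abs_nonneg _) ((abs_nonneg _).trans (hh x y))
  rw [partLaw_eq, integral_normalize, Measure.real, H.ancestorSum_univ hs hs0,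
    ENNReal.toReal_ofReal (H.sum_adj_pos hs hs0).le, Measure.sum_fintype,
    integral_finsetSum_measure]
  · congr 1
    · have e1 (i : Fin N) : ∫ q, q.2.2 * (q.2.1 * f q.1 + g q.1)
          ∂(ENNReal.ofReal (ϑ n (s i).1 * (s i).2.2) •
            ancestorLaw μ R lhat htil ϑ pr M s (s i).1) =
          ∫ y, (s i).2.2 * (lEps R lhat n (s i).1 y * (T y * f y + g y)) ∂μ (n + 1) := by
        rw [integral_smul_measure, ENNReal.toReal_ofReal
          (mul_nonneg (H.adj_pos n _).le (hs i)), smul_eq_mul, mul_comm (ϑ n _), mul_assoc,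
          H.integral_ancestorLaw hτ hs hs0 hM hf hfC hg hgC, integral_const_mul]
      have e2 (i : Fin N) : (s i).2.2 * ((s i).2.1 * Lop μ (lEps R lhat) n f (s i).1 +
            Lop μ (lEps R lhat) n (fun y => htil n (s i).1 y * f y + g y) (s i).1) =
          ∫ y, (s i).2.2 * ((s i).2.1 * (lEps R lhat n (s i).1 y * f y) +
            lEps R lhat n (s i).1 y * (htil n (s i).1 y * f y + g y)) ∂μ (n + 1) := by
        rw [integral_const_mul, integral_add, integral_const_mul]
        · rfl
        · exact (H.integrable_lEps_mul n _ hf hfC).const_mul _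
        · exact H.integrable_lEps_mul n _ (hhm _) (hhb _)
      simp only [e1, e2]
      rw [← integral_finsetSum, ← integral_finsetSum]
      · refine integral_congr_ae (ae_of_all _ fun y => ?_)
        have hpos := sum_weight_lEps_pos (R := R) H.lhat_meas H.lhat_pos H.lhat_bdd hs hs0 y
        have hTy : (∑ j, (s j).2.2 * lEps R lhat n (s j).1 y) * T y =
            ∑ j, (s j).2.2 * lEps R lhat n (s j).1 y * ((s j).2.1 + htil n (s j).1 y) := by
          rw [hT]
          simp only [integral_bsLaw H.lhat_meas H.lhat_pos H.lhat_bdd H.htil_meas hs hs0 hM y]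
          field_simp
        calc _ = (∑ j, (s j).2.2 * lEps R lhat n (s j).1 y) * T y * f y +
              ∑ j, (s j).2.2 * lEps R lhat n (s j).1 y * g y := by
              simp only [Finset.sum_mul, ← Finset.sum_add_distrib]
              exact Finset.sum_congr rfl fun j _ => by ring
          _ = _ := by
              rw [hTy, Finset.sum_mul, ← Finset.sum_add_distrib]
              exact Finset.sum_congr rfl fun j _ => by ring
      · exact fun i _ => (((H.integrable_lEps_mul n _ hf hfC).const_mul _).add
          (H.integrable_lEps_mul n _ (hhm _) (hhb _))).const_mul _
      · exact fun i _ => (H.integrable_lEps_mul n _ hTfm hTfb).const_mul _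
    · exact Finset.sum_congr rfl fun i _ => mul_comm _ _
  · intro i _
    refine Integrable.smul_measure ?_ ENNReal.ofReal_ne_top
    refine Integrable.of_bound (by fun_prop) (Cw * ((Cτ + Ch) * Cf + Cg)) ?_
    filter_upwards [H.ae_ancestorLaw (M := M) hτ hh (hw n) hM (s i).1] with q hq
    exact abs_update_le hfC hgC hq

end Regular
end Particle

section PathIntegral

omit [∀ n, MeasurableSpace (X n)] in
lemma addFun_snoc (htil : ∀ k, X k → X (k + 1) → ℝ) (n : ℕ) (p : Path X n) (y : X (n + 1)) :
    addFun htil (n + 1) (Fin.snoc p y : Path X (n + 1)) =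
      addFun htil n p + htil n (p (Fin.last n)) y := by
  have hc (m : Fin (n + 1)) : (Fin.snoc p y : Path X (n + 1)) m.castSucc = p m :=
    Fin.snoc_castSucc (α := fun i : Fin (n + 2) => X i) y p m
  have hl : (Fin.snoc p y : Path X (n + 1)) (Fin.last (n + 1)) = y :=
    Fin.snoc_last (α := fun i : Fin (n + 2) => X i) y p
  rw [addFun, Fin.sum_univ_castSucc]
  congr 1
  · refine Finset.sum_congr rfl fun m _ => ?_
    exact congrArg₂ (htil m) (hc m.castSucc) (hc m.succ)
  · exact congrArg₂ (htil n) (hc (Fin.last n)) hl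

/-- The unnormalised path integral of `h_n(x_{0:n}) f(x_n) + g(x_n)`, for the additive
functional `h_n`. -/
noncomputable def affineInt (μ : ∀ n, Measure (X n)) (χ : Measure (X 0))
    (d htil : ∀ k, X k → X (k + 1) → ℝ) (n : ℕ) (f g : X n → ℝ) : ℝ :=
  pathInt μ χ d n fun p => addFun htil n p * f (p (Fin.last n)) + g (p (Fin.last n))

lemma affineInt_zero (μ : ∀ n, Measure (X n)) (χ : Measure (X 0))
    (d htil : ∀ k, X k → X (k + 1) → ℝ) (f g : X 0 → ℝ) :
    affineInt μ χ d htil 0 f g = ∫ x, g x ∂χ := by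
  simp [affineInt, pathInt, addFun]

/-- A bounded measurable real function. -/
structure BddMeas {α : Type*} [MeasurableSpace α] (f : α → ℝ) : Prop where
  meas : Measurable f
  bdd : ∃ C, ∀ x, |f x| ≤ C

lemma BddMeas.const {α : Type*} [MeasurableSpace α] (c : ℝ) : BddMeas fun _ : α => c :=
  ⟨measurable_const, |c|, fun _ => le_rfl⟩

/-- The one-step update `x ↦ ∫ d_n(x, y) (h̃_n(x, y) f(y) + g(y)) μ_{n+1}(dy)`. -/
noncomputable def affineStep (μ : ∀ n, Measure (X n)) (d htil : ∀ k, X k → X (k + 1) → ℝ) (n : ℕ)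
    (f g : X (n + 1) → ℝ) (x : X n) : ℝ :=
  Lop μ d n (fun y => htil n x y * f y + g y) x

namespace Regular

variable {μ : ∀ n, Measure (X n)} {R : ∀ k, Kernel (X k × X (k + 1)) (Z k)}
  [∀ k, IsMarkovKernel (R k)]
  {lhat : ∀ k, X k → X (k + 1) → Z k → ℝ} {htil : ∀ k, X k → X (k + 1) → ℝ}
  {ϑ : ∀ k, X k → ℝ} {pr : ∀ k, X k → X (k + 1) → ℝ}
  (H : Regular μ R lhat htil ϑ pr) {n : ℕ}
include H

omit [∀ k, IsMarkovKernel (R k)] in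
lemma bddMeas_adj (n : ℕ) : BddMeas (ϑ n) := by
  obtain ⟨C, hC⟩ := H.adj_bdd n
  exact ⟨H.adj_meas n, C, fun x => (abs_of_pos (H.adj_pos n x)).trans_le (hC x)⟩

omit [∀ k, IsMarkovKernel (R k)] in
lemma bddMeas_htil_mul_add {f g : X (n + 1) → ℝ} (hf : BddMeas f) (hg : BddMeas g) :
    ∃ C, 0 ≤ C ∧ ∀ x y, |htil n x y * f y + g y| ≤ C := by
  obtain ⟨Cf, hCf⟩ := hf.bdd
  obtain ⟨Cg, hCg⟩ := hg.bdd
  obtain ⟨Ch, hCh⟩ := H.htil_bdd n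
  refine ⟨max (Ch * Cf + Cg) 0, le_max_right _ _, fun x y => le_max_of_le_left ?_⟩
  refine (abs_add_le _ _).trans (add_le_add ?_ (hCg y))
  rw [abs_mul]
  exact mul_le_mul (hCh x y) (hCf y) (abs_nonneg _) ((abs_nonneg _).trans (hCh x y))

omit [∀ k, IsMarkovKernel (R k)] in
lemma measurable_htil_mul_add {f g : X (n + 1) → ℝ} (hf : BddMeas f) (hg : BddMeas g) :
    Measurable fun q : X n × X (n + 1) => htil n q.1 q.2 * f q.2 + g q.2 :=
  ((H.htil_meas n).mul (hf.meas.comp measurable_snd)).add (hg.meas.comp measurable_snd)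

lemma abs_Lop_le {k : X (n + 1) → ℝ} {C D : ℝ} (hC : ∀ y, |k y| ≤ C)
    (hD : ∀ (x : X n) y, lEps R lhat n x y ≤ D * (ϑ n x * pr n x y)) (x : X n) :
    |Lop μ (lEps R lhat) n k x| ≤ D * C * ϑ n x := by
  have h := norm_integral_le_of_norm_le (f := fun y => lEps R lhat n x y * k y)
    ((H.integrable_pr n x).const_mul (D * C * ϑ n x)) (ae_of_all _ fun y => ?_)
  · simpa [Lop, integral_const_mul, H.integral_pr] using h
  · rw [Real.norm_eq_abs, abs_mul, abs_of_pos (H.lEps_pos n x y)]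
    calc _ ≤ D * (ϑ n x * pr n x y) * C :=
          mul_le_mul (hD x y) (hC y) (abs_nonneg _) ((H.lEps_pos n x y).le.trans (hD x y))
      _ = _ := by ring

lemma affineInt_succ (χ : Measure (X 0)) {f g : X (n + 1) → ℝ} (hf : BddMeas f)
    (hg : BddMeas g) :
    affineInt μ χ (lEps R lhat) htil (n + 1) f g =
      affineInt μ χ (lEps R lhat) htil n (Lop μ (lEps R lhat) n f)
        (affineStep μ (lEps R lhat) htil n f g) := by
  obtain ⟨Cf, hCf⟩ := hf.bdd
  obtain ⟨C, -, hC⟩ := H.bddMeas_htil_mul_add (n := n) hf hg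
  rw [affineInt, affineInt, pathInt]
  congr 1
  funext p
  set x := p (Fin.last n)
  have hl (y : X (n + 1)) : (Fin.snoc p y : Path X (n + 1)) (Fin.last (n + 1)) = y :=
    Fin.snoc_last (α := fun i : Fin (n + 2) => X i) y p
  have hm : Measurable fun y => htil n x y * f y + g y :=
    (H.measurable_htil_mul_add hf hg).comp measurable_prodMk_left
  calc _ = ∫ y, (addFun htil n p * (lEps R lhat n x y * f y) +
        lEps R lhat n x y * (htil n x y * f y + g y)) ∂μ (n + 1) := by
        refine integral_congr_ae (ae_of_all _ fun y => ?_)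
        simp only [addFun_snoc, hl]
        ring
    _ = _ := by
        rw [integral_add ((H.integrable_lEps_mul n x hf.meas hCf).const_mul _)
          (H.integrable_lEps_mul n x hm (hC x)), integral_const_mul]
        rfl

variable [∀ n, SigmaFinite (μ n)]

lemma bddMeas_affineStep {f g : X (n + 1) → ℝ} (hf : BddMeas f) (hg : BddMeas g) :
    BddMeas (affineStep μ (lEps R lhat) htil n f g) := by
  obtain ⟨C, hC0, hC⟩ := H.bddMeas_htil_mul_add (n := n) hf hg
  obtain ⟨D, hD0, hD⟩ := H.exists_lEps_bound
  obtain ⟨T, hT⟩ := H.adj_bdd n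
  refine ⟨?_, D * C * T, fun x => (H.abs_Lop_le (hC x) (hD n) x).trans ?_⟩
  · exact ((measurable_lEps H.lhat_meas n).mul
      (H.measurable_htil_mul_add hf hg)).stronglyMeasurable.integral_prod_right.measurable
  · exact mul_le_mul_of_nonneg_left (hT x) (by positivity)

lemma bddMeas_Lop {f : X (n + 1) → ℝ} (hf : BddMeas f) :
    BddMeas (Lop μ (lEps R lhat) n f) := by
  have h := H.bddMeas_affineStep (BddMeas.const 0) hf
  unfold affineStep at h
  simpa only [mul_zero, zero_add] using h

lemma affineInt_pos {χ : Measure (X 0)} [IsFiniteMeasure χ] (hχ : 0 < ∫ _, (1 : ℝ) ∂χ) (n : ℕ)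
    {g : X n → ℝ} (hg : BddMeas g) (hg0 : ∀ x, 0 < g x) :
    0 < affineInt μ χ (lEps R lhat) htil n (fun _ => 0) g := by
  induction n with
  | zero =>
    obtain ⟨C, hC⟩ := hg.bdd
    have hi : Integrable g χ :=
      Integrable.of_bound hg.meas.aestronglyMeasurable C (ae_of_all _ hC)
    have hsupp : Function.support g = Set.univ := Set.eq_univ_of_forall fun x => (hg0 x).ne'
    rw [affineInt_zero, integral_pos_iff_support_of_nonneg (fun x => (hg0 x).le) hi, hsupp]
    rw [pos_iff_ne_zero]
    intro h0
    simp [Measure.measure_univ_eq_zero.1 h0] at hχ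
  | succ n ih =>
    obtain ⟨C, hC⟩ := hg.bdd
    rw [H.affineInt_succ χ (BddMeas.const 0) hg]
    have e1 : Lop μ (lEps R lhat) n (fun _ => 0) = fun _ => 0 := by
      funext x
      simp [Lop]
    rw [e1]
    refine ih (H.bddMeas_affineStep (BddMeas.const 0) hg) fun x => ?_
    have e2 : affineStep μ (lEps R lhat) htil n (fun _ => 0) g x =
        ∫ y, lEps R lhat n x y * g y ∂μ (n + 1) := by
      simp [affineStep, Lop]
    have hpos (y : X (n + 1)) : 0 < lEps R lhat n x y * g y := mul_pos (H.lEps_pos n x y) (hg0 y)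
    have hsupp : Function.support (fun y => lEps R lhat n x y * g y) = Set.univ :=
      Set.eq_univ_of_forall fun y => (hpos y).ne'
    rw [e2, integral_pos_iff_support_of_nonneg (fun y => (hpos y).le)
      (H.integrable_lEps_mul n x hg.meas hC), hsupp, pos_iff_ne_zero]
    intro h0
    have := H.pr_markov n x
    simp [Measure.measure_univ_eq_zero.1 h0] at this

end Regular

end PathIntegral

section ParticleSystem

/-- The unnormalised particle average of `τ f + g`. -/
noncomputable def particleMean {N n : ℕ} (f g : X n → ℝ) (s : PState X N n) : ℝ :=
  (∑ i, (s i).2.2 * ((s i).2.1 * f (s i).1 + g (s i).1)) / N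

lemma measurable_particleMean {N n : ℕ} {f g : X n → ℝ} (hf : Measurable f) (hg : Measurable g) :
    Measurable (particleMean (N := N) f g) := by
  unfold particleMean
  fun_prop

omit [∀ n, MeasurableSpace (X n)] in
lemma particleMean_zero_left {N n : ℕ} (g : X n → ℝ) (s : PState X N n) :
    particleMean (fun _ => 0) g s = (∑ i, (s i).2.2 * g (s i).1) / N := by
  simp [particleMean]

omit [∀ n, MeasurableSpace (X n)] in
lemma abs_particleMean_le {N n : ℕ} {f g v : X n → ℝ} {s : PState X N n} {C : ℝ}
    (hs : ∀ i, 0 ≤ (s i).2.2) (hC : ∀ i, |(s i).2.1 * f (s i).1 + g (s i).1| ≤ C * v (s i).1) :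
    |particleMean f g s| ≤ C * particleMean (fun _ => 0) v s := by
  rw [particleMean_zero_left, particleMean, abs_div, Nat.abs_cast, mul_div_assoc', Finset.mul_sum]
  gcongr
  refine (Finset.abs_sum_le_sum_abs _ _).trans (Finset.sum_le_sum fun i _ => ?_)
  rw [abs_mul, abs_of_nonneg (hs i), mul_left_comm]
  exact mul_le_mul_of_nonneg_left (hC i) (hs i)

lemma measurableSet_particle_bounds {N n : ℕ} (Cτ Cω : ℝ) : MeasurableSet
    {s : PState X N n | ∀ i, |(s i).2.1| ≤ Cτ ∧ 0 ≤ (s i).2.2 ∧ (s i).2.2 ≤ Cω} := by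
  have := MeasurableSet.iInter fun i : Fin N =>
    (measurable_pi_apply (X := fun _ => X n × ℝ × ℝ) i) (measurableSet_stat_weight Cτ Cω)
  simpa [Set.ofPred_forall] using this

namespace Regular

variable {μ : ∀ n, Measure (X n)} {χ ν : Measure (X 0)} [IsProbabilityMeasure ν]
  {R : ∀ k, Kernel (X k × X (k + 1)) (Z k)} [∀ k, IsMarkovKernel (R k)]
  {lhat : ∀ k, X k → X (k + 1) → Z k → ℝ} {htil : ∀ k, X k → X (k + 1) → ℝ}
  {ϑ : ∀ k, X k → ℝ} {pr : ∀ k, X k → X (k + 1) → ℝ} {wm1 : X 0 → ℝ} {M : ℕ}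

instance isFiniteMeasure_partLaw {N n : ℕ} (s : PState X N n) :
    IsFiniteMeasure (partLaw μ R lhat htil ϑ pr M n s) :=
  ⟨(normalize_univ_le_one _).trans_lt ENNReal.one_lt_top⟩

omit [∀ k, IsMarkovKernel (R k)] in
lemma pi_partLaw_univ_le_one {N n : ℕ} (s : PState X N n) :
    (Measure.pi fun _ : Fin N => partLaw μ R lhat htil ϑ pr M n s) Set.univ ≤ 1 := by
  rw [Measure.pi_univ]
  exact Finset.prod_le_one' fun _ _ => normalize_univ_le_one _

lemma measurable_initialState (hwm1meas : Measurable wm1) {N : ℕ} :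
    Measurable fun (ξ : Fin N → X 0) i => (ξ i, (0 : ℝ), wm1 (ξ i)) := by
  fun_prop

omit [∀ k, IsMarkovKernel (R k)] in
lemma sysLaw_univ_le_one (hwm1meas : Measurable wm1) (N n : ℕ) :
    sysLaw μ ν R lhat htil ϑ pr wm1 N M n Set.univ ≤ 1 := by
  induction n with
  | zero =>
    rw [sysLaw, Measure.map_apply (measurable_initialState hwm1meas) MeasurableSet.univ]
    exact prob_le_one
  | succ n ih =>
    refine (Measure.bind_apply_le _ MeasurableSet.univ).trans ?_
    calc _ ≤ ∫⁻ _, 1 ∂(sysLaw μ ν R lhat htil ϑ pr wm1 N M n) :=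
          lintegral_mono fun s => pi_partLaw_univ_le_one s
      _ ≤ _ := by simpa using ih

variable (H : Regular μ R lhat htil ϑ pr)
include H

omit [IsProbabilityMeasure ν] in
lemma ae_sysLaw (hwm1meas : Measurable wm1) (hwm1nn : ∀ x, 0 ≤ wm1 x)
    (hwm1bdd : ∃ C, ∀ x, wm1 x ≤ C) (hM : 1 ≤ M) (n : ℕ) :
    ∃ Cτ Cω, 0 ≤ Cτ ∧ ∀ N, ∀ᵐ s ∂(sysLaw μ ν R lhat htil ϑ pr wm1 N M n),
      ∀ i, |(s i).2.1| ≤ Cτ ∧ 0 ≤ (s i).2.2 ∧ (s i).2.2 ≤ Cω := by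
  induction n with
  | zero =>
    obtain ⟨C, hC⟩ := hwm1bdd
    refine ⟨0, C, le_rfl, fun N => ?_⟩
    rw [sysLaw, ae_map_iff (measurable_initialState hwm1meas).aemeasurable
      (measurableSet_particle_bounds 0 C)]
    exact ae_of_all _ fun ξ i => ⟨by simp, hwm1nn _, hC _⟩
  | succ n ih =>
    obtain ⟨Cτ, Cω, hC0, hC⟩ := ih
    obtain ⟨Ch, hh⟩ := H.htil_bdd n
    obtain ⟨Cw, -, hw⟩ := H.exists_weight_bound
    have hh' (x : X n) (y : X (n + 1)) : |htil n x y| ≤ max Ch 0 := le_max_of_le_left (hh x y)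
    refine ⟨Cτ + max Ch 0, Cw, by positivity, fun N => ?_⟩
    refine ae_bind (measurableSet_particle_bounds _ _) ?_
    filter_upwards [hC N] with s hs
    refine ae_all_iff.2 fun i => ?_
    exact (Measure.tendsto_eval_ae_ae
      (μ := fun _ : Fin N => partLaw μ R lhat htil ϑ pr M n s) (i := i)).eventually
      (H.ae_partLaw (M := M) (fun i => (hs i).1) hh' (hw n) hM)

lemma pi_partLaw_hoeffding {N n : ℕ} {s : PState X N n} {Cτ Ch Cw Cf Cg : ℝ}
    (hτ : ∀ i, |(s i).2.1| ≤ Cτ) (hs : ∀ i, 0 ≤ (s i).2.2) (hh : ∀ x y, |htil n x y| ≤ Ch)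
    (hw : ∀ (x : X n) y z, lhat n x y z ≤ Cw * (ϑ n x * pr n x y)) (hM : 1 ≤ M)
    {f g : X (n + 1) → ℝ} (hf : Measurable f) (hfC : ∀ y, |f y| ≤ Cf) (hg : Measurable g)
    (hgC : ∀ y, |g y| ≤ Cg) (hN : 1 ≤ N) {ε : ℝ} (hε : 0 < ε) :
    (Measure.pi fun _ : Fin N => partLaw μ R lhat htil ϑ pr M n s)
      {s' | ε ≤ |particleMean f g s' -
        particleMean (Lop μ (lEps R lhat) n f) (affineStep μ (lEps R lhat) htil n f g) s /
          particleMean (fun _ => 0) (ϑ n) s|} ≤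
      ENNReal.ofReal (2 *
        Real.exp (-((2 * max (Cw * ((Cτ + Ch) * Cf + Cg)) 1 ^ 2)⁻¹ * N * ε ^ 2))) := by
  have hN0 : (N : ℝ) ≠ 0 := by positivity
  by_cases hs0 : ∃ i, 0 < (s i).2.2
  · have := H.isProbabilityMeasure_partLaw (M := M) hs hs0
    have hae : ∀ᵐ q ∂(partLaw μ R lhat htil ϑ pr M n s),
        |q.2.2 * (q.2.1 * f q.1 + g q.1)| ≤ max (Cw * ((Cτ + Ch) * Cf + Cg)) 1 := by
      filter_upwards [H.ae_partLaw (M := M) hτ hh hw hM] with q hq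
      exact le_max_of_le_left (abs_update_le hfC hgC hq)
    have h := hoeffding_pi (partLaw μ R lhat htil ϑ pr M n s)
      (g := fun q => q.2.2 * (q.2.1 * f q.1 + g q.1)) (by fun_prop) (by positivity) hae hN hε
    rw [H.integral_partLaw hτ hs hs0 hM hf hfC hg hgC] at h
    rw [particleMean_zero_left, particleMean, div_div_div_cancel_right₀ hN0]
    exact h
  · have hzero (i : Fin N) : (s i).2.2 = 0 :=
      le_antisymm (not_lt.1 fun h => hs0 ⟨i, h⟩) (hs i)
    have hpart : partLaw μ R lhat htil ϑ pr M n s = 0 := by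
      simp [partLaw, hzero, normalize]
    have huniv : (Measure.pi fun _ : Fin N => partLaw μ R lhat htil ϑ pr M n s) Set.univ = 0 := by
      rw [Measure.pi_univ, hpart]
      simp [Nat.one_le_iff_ne_zero.1 hN]
    rw [measure_mono_null (Set.subset_univ _) huniv]
    exact zero_le

variable [∀ n, SigmaFinite (μ n)] [IsFiniteMeasure χ]

theorem expConc_particleMean (hχ : 0 < ∫ _, (1 : ℝ) ∂χ) (hwm1meas : Measurable wm1)
    (hwm1nn : ∀ x, 0 ≤ wm1 x) (hRN : χ = ν.withDensity fun x => ENNReal.ofReal (wm1 x))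
    (hwm1bdd : ∃ C, ∀ x, wm1 x ≤ C) (hM : 1 ≤ M) (n : ℕ) :
    ∃ κ > 0, ∀ f g : X n → ℝ, BddMeas f → BddMeas g →
      ExpConc (fun N => sysLaw μ ν R lhat htil ϑ pr wm1 N M n) (fun _ => particleMean f g)
        (κ * affineInt μ χ (lEps R lhat) htil n f g) := by
  induction n with
  | zero =>
    refine ⟨1, one_pos, fun f g hf hg => ?_⟩
    obtain ⟨C, hC⟩ := hwm1bdd
    obtain ⟨Cg, hCg⟩ := hg.bdd
    have hb : ∀ x, |wm1 x * g x| ≤ max (C * Cg) 1 := fun x => by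
      rw [abs_mul, abs_of_nonneg (hwm1nn x)]
      exact le_max_of_le_left
        (mul_le_mul (hC x) (hCg x) (abs_nonneg _) ((hwm1nn x).trans (hC x)))
    have hχg : ∫ x, g x ∂χ = ∫ x, wm1 x * g x ∂ν := by
      rw [hRN, integral_withDensity_eq_integral_toReal_smul hwm1meas.ennreal_ofReal (by simp)]
      exact integral_congr_ae (ae_of_all _ fun x => by simp [ENNReal.toReal_ofReal (hwm1nn x)])
    refine ⟨2, two_pos, (2 * max (C * Cg) 1 ^ 2)⁻¹, by positivity, fun N hN ε hε => ?_⟩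
    have hset : MeasurableSet {s : PState X N 0 |
        ε ≤ |particleMean f g s - 1 * affineInt μ χ (lEps R lhat) htil 0 f g|} :=
      measurableSet_le measurable_const
        ((measurable_particleMean hf.meas hg.meas).sub_const _).abs
    change sysLaw μ ν R lhat htil ϑ pr wm1 N M 0 _ ≤ _
    rw [sysLaw, Measure.map_apply (measurable_initialState hwm1meas) hset, one_mul,
      affineInt_zero, hχg]
    have h := hoeffding_pi ν (hwm1meas.mul hg.meas) (by positivity) (ae_of_all _ hb) hN hε
    simpa [particleMean] using h
  | succ n ih =>
    obtain ⟨κ, hκ, hconc⟩ := ih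
    obtain ⟨Cτ, Cω, hCτ, hbounds⟩ := H.ae_sysLaw (ν := ν) hwm1meas hwm1nn hwm1bdd hM n
    obtain ⟨Ch, hh⟩ := H.htil_bdd n
    obtain ⟨Cw, -, hw⟩ := H.exists_weight_bound
    obtain ⟨D, hD0, hD⟩ := H.exists_lEps_bound
    have hnorm := H.affineInt_pos hχ n (H.bddMeas_adj n) (H.adj_pos n)
    refine ⟨(affineInt μ χ (lEps R lhat) htil n (fun _ => 0) (ϑ n))⁻¹, inv_pos.2 hnorm,
      fun f g hf hg => ?_⟩
    obtain ⟨Cf, hCf⟩ := hf.bdd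
    obtain ⟨Cg, hCg⟩ := hg.bdd
    obtain ⟨C, hC0, hC⟩ := H.bddMeas_htil_mul_add (n := n) hf hg
    have hratio := (hconc _ _ (H.bddMeas_Lop hf) (H.bddMeas_affineStep hf hg)).div
      (hconc _ _ (BddMeas.const 0) (H.bddMeas_adj n)) (by positivity)
      (C := max (Cτ * (D * Cf) + D * C) 1) (by positivity) fun N => by
        filter_upwards [hbounds N] with s hs
        refine abs_particleMean_le (fun i => (hs i).2.1) fun i => ?_
        have h1 := H.abs_Lop_le hCf (hD n) (s i).1
        have h2 := H.abs_Lop_le (hC (s i).1) (hD n) (s i).1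
        calc _ ≤ |(s i).2.1| * |Lop μ (lEps R lhat) n f (s i).1| +
              |affineStep μ (lEps R lhat) htil n f g (s i).1| := by
              rw [← abs_mul]
              exact abs_add_le _ _
          _ ≤ Cτ * (D * Cf * ϑ n (s i).1) + D * C * ϑ n (s i).1 :=
              add_le_add (mul_le_mul (hs i).1 h1 (abs_nonneg _) hCτ) h2
          _ = (Cτ * (D * Cf) + D * C) * ϑ n (s i).1 := by ring
          _ ≤ _ := mul_le_mul_of_nonneg_right (le_max_left _ _) (H.adj_pos n _).le
    rw [mul_div_mul_left _ _ hκ.ne', ← H.affineInt_succ χ hf hg, div_eq_inv_mul] at hratio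
    refine ExpConc.bind (b := (2 * max (Cw * ((Cτ + Ch) * Cf + Cg)) 1 ^ 2)⁻¹)
      (fun N => sysLaw_univ_le_one hwm1meas N n) hratio
      (fun N => measurable_particleMean hf.meas hg.meas) (by positivity) (fun N hN => ?_)
      (fun N _ => ae_of_all _ fun s => pi_partLaw_univ_le_one s)
    filter_upwards [hbounds N] with s hs ε hε
    exact H.pi_partLaw_hoeffding (fun i => (hs i).1) (fun i => (hs i).2.1) hh (hw n) hM
      hf.meas hCf hg.meas hCg hN hε

end Regular

end ParticleSystem

/-- **Hoeffding-type exponential concentration inequality for the pseudo-marginal PaRIS**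
(Theorem 1): for every `n`, additive functional `h_n`, and `M ≥ 1`, there are constants
`c, d > 0` such that for all `N ≥ 1` and `ϵ > 0`, the probability that the self-normalised
PaRIS estimator deviates from the skew smoothed expectation `φ^ε_{0:n} h_n` by at least `ϵ`
is at most `c exp(−d N ϵ²)`. -/
theorem paris_hoeffding
    -- the model
    (μ : ∀ n, Measure (X n)) [∀ n, SigmaFinite (μ n)]
    (χ : Measure (X 0)) [IsFiniteMeasure χ]
    -- (H1): auxiliary kernels and transition-density estimators
    (R : ∀ k, Kernel (X k × X (k + 1)) (Z k)) [∀ k, IsMarkovKernel (R k)]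
    (lhat : ∀ k, X k → X (k + 1) → Z k → ℝ)
    (hlhatmeas : ∀ k, Measurable fun q : (X k × X (k + 1)) × Z k => lhat k q.1.1 q.1.2 q.2)
    (hlhatpos : ∀ k x y z, 0 < lhat k x y z)
    -- positivity of the skew normalising constants
    (hZpos : ∀ n, 0 < pathInt μ χ (lEps R lhat) n fun _ => 1)
    -- adjustment weights, proposal densities, initial proposal
    (ϑ : ∀ k, X k → ℝ) (pr : ∀ k, X k → X (k + 1) → ℝ)
    (ν : Measure (X 0)) [IsProbabilityMeasure ν] (wm1 : X 0 → ℝ)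
    (hϑmeas : ∀ k, Measurable (ϑ k)) (hϑpos : ∀ k x, 0 < ϑ k x)
    (hprmeas : ∀ k, Measurable fun q : X k × X (k + 1) => pr k q.1 q.2)
    (hprpos : ∀ k x y, 0 < pr k x y)
    (hprmarkov : ∀ k x, ∫⁻ y, ENNReal.ofReal (pr k x y) ∂μ (k + 1) = 1)
    (hwm1meas : Measurable wm1) (hwm1nn : ∀ x, 0 ≤ wm1 x)
    (hRN : χ = ν.withDensity fun x => ENNReal.ofReal (wm1 x))
    -- (H2): boundedness
    (hϑbdd : ∀ k, ∃ C, ∀ x, ϑ k x ≤ C)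
    (hwhatbdd : ∃ C, ∀ k (x : X k) y z, lhat k x y z / (ϑ k x * pr k x y) ≤ C)
    (hwepsbdd : ∃ C, ∀ k (x : X k) y, lEps R lhat k x y / (ϑ k x * pr k x y) ≤ C)
    (hwm1bdd : ∃ C, ∀ x, wm1 x ≤ C)
    -- the additive functional
    (htil : ∀ k, X k → X (k + 1) → ℝ)
    (htilmeas : ∀ k, Measurable fun q : X k × X (k + 1) => htil k q.1 q.2)
    (htilbdd : ∀ k, ∃ C, ∀ x y, |htil k x y| ≤ C)
    (n M : ℕ) (hM : 1 ≤ M) :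
    ∃ c > (0 : ℝ), ∃ d > (0 : ℝ), ∀ N : ℕ, 1 ≤ N → ∀ ϵ : ℝ, 0 < ϵ →
      sysLaw μ ν R lhat htil ϑ pr wm1 N M n
          {s | ϵ ≤ |estParis s - smoothPath μ χ (lEps R lhat) n (addFun htil n)|} ≤
        ENNReal.ofReal (c * Real.exp (-(d * N * ϵ ^ 2))) := by
  have H : Regular μ R lhat htil ϑ pr := ⟨hlhatmeas, hlhatpos, hϑmeas, hϑpos, hϑbdd, hprmeas,
    hprpos, hprmarkov, hwhatbdd, htilmeas, htilbdd⟩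
  obtain ⟨κ, hκ, hconc⟩ := H.expConc_particleMean (hZpos 0) hwm1meas hwm1nn hRN hwm1bdd hM n
  obtain ⟨Cτ, Cω, hCτ, hbounds⟩ := H.ae_sysLaw (ν := ν) hwm1meas hwm1nn hwm1bdd hM n
  have hone : affineInt μ χ (lEps R lhat) htil n (fun _ => 0) (fun _ => 1) =
      pathInt μ χ (lEps R lhat) n fun _ => 1 := by
    simp [affineInt]
  have hadd : affineInt μ χ (lEps R lhat) htil n (fun _ => 1) (fun _ => 0) =
      pathInt μ χ (lEps R lhat) n (addFun htil n) := by
    simp [affineInt]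
  have hratio := (hconc _ _ (BddMeas.const 1) (BddMeas.const 0)).div
    (hconc _ _ (BddMeas.const 0) (BddMeas.const 1)) (mul_pos hκ (hone ▸ hZpos n))
    (C := Cτ + 1) (by positivity) fun N => by
      filter_upwards [hbounds N] with s hs
      refine abs_particleMean_le (fun i => (hs i).2.1) fun i => ?_
      simpa using (hs i).1.trans (le_add_of_nonneg_right zero_le_one)
  rw [mul_div_mul_left _ _ hκ.ne', hone, hadd] at hratio
  obtain ⟨c, hc, d, hd, h⟩ := hratio
  refine ⟨c, hc, d, hd, fun N hN ϵ hϵ => ?_⟩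
  have hN0 : (N : ℝ) ≠ 0 := by positivity
  have hest (s : PState X N n) : estParis s =
      particleMean (fun _ => 1) (fun _ => 0) s / particleMean (fun _ => 0) (fun _ => 1) s := by
    simp only [estParis, particleMean, mul_one, mul_zero, add_zero, zero_add]
    rw [div_div_div_cancel_right₀ hN0]
  simp only [hest]
  exact h N hN ϵ hϵ

end PmParis
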